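/- arXiv:quant-ph/0608197 — 4 statements merged into one kernel-verified Lean document; each statement's English description precedes it below -/
import Mathlib

section
/- Let ψ ∈ (ℂ^d)^{⊗N} be a normalized state with an OBC MPS representation by matrices B^{[m]}_i. Then there exist (in general non-square) matrices Y_1,…,Y_{N−1} and Z_1,…,Z_{N−1} with Y_m Z_m = 1 for all m, such that the matrices defined by A^{[1]}_i = B^{[1]}_i Z_1, A^{[m]}_i = Y_{m−1} B^{[m]}_i Z_m for 1 < m < N, and A^{[N]}_i = Y_{N−1} B^{[N]}_i again form an OBC MPS representation of ψ and satisfy the canonical conditions: ∑_i A^{[m]}_i A^{[m]†}_i = 1 for all m, and ∑_i A^{[m]†}_i Λ^{[m−1]} A^{[m]}_i = Λ^{[m]} for all m, where Λ^{[0]} = Λ^{[N]} = 1 and each intermediate Λ^{[m]} is a diagonal, positive-definite matrix with trace 1. -/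
open scoped Matrix ComplexOrder

/-- Partial products of an open-boundary-condition MPS. -/
noncomputable def obcProd {d : ℕ} (D : ℕ → ℕ)
    (A : (m : ℕ) → Fin d → Matrix (Fin (D m)) (Fin (D (m + 1))) ℂ)
    (i : ℕ → Fin d) : (m : ℕ) → Matrix (Fin (D 0)) (Fin (D m)) ℂ
  | 0 => 1
  | m + 1 => obcProd D A i m * A m (i m)

section PosSemidef

open Matrix

variable {ι n l p : Type*} [Fintype ι] [Fintype n]

open scoped MatrixOrder Matrix.Norms.L2Operator in
theorem Matrix.PosSemidef.exists_eq_conjTranspose_mul_self {G : Matrix n n ℂ}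
    (hG : G.PosSemidef) : ∃ C : Matrix n n ℂ, G = Cᴴ * C := by
  classical
  exact CStarAlgebra.nonneg_iff_eq_star_mul_self.mp hG.nonneg

/-- A positive semidefinite matrix annihilates every vector on which its quadratic form
vanishes. -/
theorem Matrix.PosSemidef.mul_eq_zero_of_conjTranspose_mul_mul_eq_zero {G : Matrix n n ℂ}
    (hG : G.PosSemidef) {X : Matrix n l ℂ} (h : Xᴴ * G * X = 0) :
    G * X = 0 := by
  obtain ⟨C, rfl⟩ := hG.exists_eq_conjTranspose_mul_self
  have hCX : (C * X)ᴴ * (C * X) = 0 := by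
    rw [conjTranspose_mul, ← h]; simp only [Matrix.mul_assoc]
  rw [conjTranspose_mul_self_eq_zero] at hCX
  rw [Matrix.mul_assoc, hCX, Matrix.mul_zero]

/-- A vanishing sum of positive semidefinite matrices has vanishing summands. -/
theorem Matrix.PosSemidef.eq_zero_of_sum_eq_zero {M : ι → Matrix n n ℂ}
    (hM : ∀ i, (M i).PosSemidef) (h : ∑ i, M i = 0) (i : ι) : M i = 0 := by
  have htr : ∑ i, (M i).trace = 0 := by rw [← trace_sum, h, trace_zero]
  rw [Finset.sum_eq_zero_iff_of_nonneg fun i _ => (hM i).trace_nonneg] at htr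
  exact (hM i).trace_eq_zero_iff.mp (htr i (Finset.mem_univ i))

/-- The kernel of `∑ i, (B i)ᴴ * G * B i` is mapped by each `B i` into the kernel of `G`. -/
theorem Matrix.PosSemidef.mul_mul_eq_zero_of_sum_mul_eq_zero [Fintype l] [Fintype p]
    {G : Matrix n n ℂ} (hG : G.PosSemidef) {B : ι → Matrix n l ℂ} {X : Matrix l p ℂ}
    (h : (∑ i, (B i)ᴴ * G * B i) * X = 0) (i : ι) : G * (B i * X) = 0 := by
  apply hG.mul_eq_zero_of_conjTranspose_mul_mul_eq_zero
  refine PosSemidef.eq_zero_of_sum_eq_zero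
    (M := fun i => (B i * X)ᴴ * G * (B i * X)) (fun i => hG.conjTranspose_mul_mul_same _) ?_ i
  calc ∑ i, (B i * X)ᴴ * G * (B i * X)
      = Xᴴ * ((∑ i, (B i)ᴴ * G * B i) * X) := by
        simp only [Matrix.sum_mul, Matrix.mul_sum, conjTranspose_mul, Matrix.mul_assoc]
    _ = 0 := by rw [h, Matrix.mul_zero]

/-- Adjoint form of `Matrix.PosSemidef.mul_mul_eq_zero_of_sum_mul_eq_zero`. -/
theorem Matrix.PosSemidef.mul_mul_eq_zero_of_mul_sum_eq_zero [Fintype l] [Fintype p]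
    {H : Matrix n n ℂ} (hH : H.PosSemidef) {B : ι → Matrix l n ℂ} {X : Matrix p l ℂ}
    (h : X * (∑ i, B i * H * (B i)ᴴ) = 0) (i : ι) : X * (B i * H) = 0 := by
  have key := hH.mul_mul_eq_zero_of_sum_mul_eq_zero (B := fun i => (B i)ᴴ) (X := Xᴴ)
    (by
      have := congr(($h)ᴴ)
      simpa only [conjTranspose_mul, conjTranspose_sum, conjTranspose_conjTranspose,
        hH.isHermitian.eq, conjTranspose_zero, Matrix.mul_assoc] using this) i
  have := congr(($key)ᴴ)
  simpa only [conjTranspose_mul, conjTranspose_conjTranspose, hH.isHermitian.eq,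
    conjTranspose_zero, Matrix.mul_assoc] using this

/-- Spectral decomposition of a positive semidefinite matrix restricted to its support. -/
theorem Matrix.PosSemidef.exists_eq_isometry_mul_diagonal_mul {M : Matrix n n ℂ} (hM : M.PosSemidef) :
    ∃ (k : ℕ) (U : Matrix n (Fin k) ℂ) (s : Fin k → ℂ), (∀ j, 0 < s j) ∧ Uᴴ * U = 1 ∧
      M = U * diagonal s * Uᴴ := by
  classical
  let V : Matrix n n ℂ := hM.isHermitian.eigenvectorUnitary
  let ev := hM.isHermitian.eigenvalues
  let e := Fintype.equivFin {j // ev j ≠ 0}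
  refine ⟨Fintype.card {j // ev j ≠ 0}, V.submatrix id (fun j => (e.symm j).1),
    fun j => ev (e.symm j), fun j => ?_, ?_, ?_⟩
  · have hpos : 0 < ev (e.symm j) :=
      lt_of_le_of_ne (hM.eigenvalues_nonneg _) (e.symm j).2.symm
    exact Complex.zero_lt_real.mpr hpos
  · have hV : Vᴴ * V = 1 := Unitary.coe_star_mul_self hM.isHermitian.eigenvectorUnitary
    ext i j
    have := congrFun (congrFun hV (e.symm i).1) (e.symm j).1
    simpa [Matrix.mul_apply, Matrix.one_apply, Subtype.ext_iff.symm] using this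
  · ext a b
    have hab := congrFun (congrFun hM.isHermitian.spectral_theorem a) b
    rw [Unitary.conjStarAlgAut_apply] at hab
    have hsum : M a b = ∑ j, V a j * (ev j : ℂ) * star (V b j) := by
      rw [hab, Matrix.mul_apply]
      simp only [Matrix.mul_diagonal]
      rfl
    rw [hsum, Matrix.mul_apply]
    simp only [Matrix.mul_diagonal, submatrix_apply, conjTranspose_apply, id]
    rw [Equiv.sum_comp e.symm (fun j : {j // ev j ≠ 0} => V a j * (ev j : ℂ) * star (V b j))]
    rw [← Finset.sum_subtype (Finset.univ.filter fun j => ev j ≠ 0) (by simp)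
      (fun j => V a j * (ev j : ℂ) * star (V b j))]
    refine (Finset.sum_filter_of_ne fun j _ hj => ?_).symm
    contrapose! hj
    simp [hj]

end PosSemidef

section Submatrix

open Matrix

variable {l m n : Type*} [Fintype n] [DecidableEq n]

theorem Matrix.submatrix_one_mul (e : l → n) (M : Matrix n m ℂ) :
    (1 : Matrix n n ℂ).submatrix e id * M = M.submatrix e id := by
  ext i j
  simp [Matrix.mul_apply, Matrix.one_apply]

theorem Matrix.mul_submatrix_id_one (e : l → n) (M : Matrix m n ℂ) :
    M * (1 : Matrix n n ℂ).submatrix id e = M.submatrix id e := by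
  ext i j
  simp [Matrix.mul_apply, Matrix.one_apply]

theorem Matrix.eq_one_of_trace_eq_one {D : ℕ} (hD : D = 1) {M : Matrix (Fin D) (Fin D) ℂ}
    (hM : M.trace = 1) : M = 1 := by
  subst hD
  ext i j
  rw [Subsingleton.elim i 0, Subsingleton.elim j 0, ← Matrix.trace_fin_one M, hM,
    Matrix.one_apply_eq]

end Submatrix

/-- Gauge matrices at one bond of an MPS whose left and right parts have Gram matrices `G`
and `H`. They bring both parts to Schmidt form: the right part becomes an isometry and the
Gram matrix of the left part becomes the diagonal matrix `Λ`. -/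
structure IsSchmidtGauge {n k : Type*} [Fintype n] [Fintype k] [DecidableEq k]
    (G H : Matrix n n ℂ) (Y : Matrix k n ℂ) (Z : Matrix n k ℂ) (Λ : Matrix k k ℂ) : Prop where
  mul_eq_one : Y * Z = 1
  eq_mul_conjTranspose : Z = H * Yᴴ
  conjTranspose_mul : Zᴴ * G = Λ * Y
  mul_mul_mul : G * (Z * (Y * H)) = G * H
  isDiag : Λ.IsDiag
  posDef : Λ.PosDef

namespace IsSchmidtGauge

open Matrix

variable {n k n' k' ι q : Type*} [Fintype n] [Fintype k] [DecidableEq k] [Fintype n']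
  [Fintype k'] [DecidableEq k'] [Fintype ι]
  {G H : Matrix n n ℂ} {Y : Matrix k n ℂ} {Z : Matrix n k ℂ} {Λ : Matrix k k ℂ}
  {G' H' : Matrix n' n' ℂ} {Y' : Matrix k' n' ℂ} {Z' : Matrix n' k' ℂ} {Λ' : Matrix k' k' ℂ}

theorem trace_eq (h : IsSchmidtGauge G H Y Z Λ) (hH : H.IsHermitian) :
    Λ.trace = (G * H).trace := by
  have hZ : Zᴴ = Y * H := by
    rw [h.eq_mul_conjTranspose, Matrix.conjTranspose_mul, conjTranspose_conjTranspose, hH.eq]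
  calc Λ.trace = (Λ * (Y * Z)).trace := by rw [h.mul_eq_one, Matrix.mul_one]
    _ = (Y * H * (G * Z)).trace := by
        rw [← Matrix.mul_assoc, ← h.conjTranspose_mul, hZ, Matrix.mul_assoc]
    _ = (G * H).trace := by
        rw [Matrix.trace_mul_comm, ← h.mul_mul_mul, Matrix.mul_assoc]

theorem mul_eq_zero (h : IsSchmidtGauge G H Y Z Λ) {X : Matrix n q ℂ} (hX : G * X = 0) :
    Y * X = 0 := by
  have : Λ * (Y * X) = 0 := by
    rw [← Matrix.mul_assoc, ← h.conjTranspose_mul, Matrix.mul_assoc, hX, Matrix.mul_zero]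
  have hdet := (isUnit_iff_isUnit_det Λ).mp h.posDef.isUnit
  rw [← nonsing_inv_mul_cancel_left Λ (Y * X) hdet, this, Matrix.mul_zero]

theorem mul_conjTranspose (h : IsSchmidtGauge G H Y Z Λ) (hH : H.IsHermitian) :
    Z * Zᴴ = Z * (Y * H) := by
  rw [h.eq_mul_conjTranspose, Matrix.conjTranspose_mul, conjTranspose_conjTranspose, hH.eq]

/-- Right-normalization of the gauged tensors. -/
theorem sum_mul_conjTranspose (h : IsSchmidtGauge G H Y Z Λ)
    (h' : IsSchmidtGauge G' H' Y' Z' Λ') (hG : G.PosSemidef) (hH' : H'.IsHermitian)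
    {B : ι → Matrix n n' ℂ} (hG' : G' = ∑ i, (B i)ᴴ * G * B i)
    (hHB : H = ∑ i, B i * H' * (B i)ᴴ) :
    ∑ i, (Y * B i * Z') * (Y * B i * Z')ᴴ = 1 := by
  have hX : (∑ i, (B i)ᴴ * G * B i) * (Z' * (Y' * H') - H') = 0 := by
    rw [← hG', Matrix.mul_sub, h'.mul_mul_mul, sub_self]
  have key (i : ι) : Y * (B i * (Z' * (Y' * H'))) = Y * (B i * H') := by
    have := h.mul_eq_zero (hG.mul_mul_eq_zero_of_sum_mul_eq_zero hX i)
    rwa [Matrix.mul_sub, Matrix.mul_sub, sub_eq_zero] at this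
  calc ∑ i, (Y * B i * Z') * (Y * B i * Z')ᴴ
      = ∑ i, Y * (B i * (Z' * Z'ᴴ)) * (B i)ᴴ * Yᴴ := by
        simp only [Matrix.conjTranspose_mul, Matrix.mul_assoc]
    _ = Y * (H * Yᴴ) := by
        simp only [h'.mul_conjTranspose hH', key]
        simp only [hHB, Matrix.mul_sum, Matrix.sum_mul, Matrix.mul_assoc]
    _ = 1 := by rw [← h.eq_mul_conjTranspose, h.mul_eq_one]

/-- The gauged tensors propagate the left Gram matrices. -/
theorem sum_conjTranspose_mul (h : IsSchmidtGauge G H Y Z Λ)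
    (h' : IsSchmidtGauge G' H' Y' Z' Λ') (hG : G.IsHermitian)
    (hH' : H'.PosSemidef) {B : ι → Matrix n n' ℂ} (hG' : G' = ∑ i, (B i)ᴴ * G * B i)
    (hHB : H = ∑ i, B i * H' * (B i)ᴴ) :
    ∑ i, (Y * B i * Z')ᴴ * Λ * (Y * B i * Z') = Λ' := by
  have hX : (G * (Z * Y) - G) * (∑ i, B i * H' * (B i)ᴴ) = 0 := by
    rw [← hHB, Matrix.sub_mul, Matrix.mul_assoc, Matrix.mul_assoc, h.mul_mul_mul, sub_self]
  have key (i : ι) : G * (Z * (Y * (B i * Z'))) = G * (B i * Z') := by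
    have := hH'.mul_mul_eq_zero_of_mul_sum_eq_zero hX i
    have := congrArg (· * Y'ᴴ) this
    simpa only [Matrix.mul_assoc, ← h'.eq_mul_conjTranspose, Matrix.sub_mul, Matrix.zero_mul,
      sub_eq_zero] using this
  have hterm (i : ι) : (Y * B i * Z')ᴴ * Λ * (Y * B i * Z') = Z'ᴴ * ((B i)ᴴ * G * B i) * Z' := by
    calc (Y * B i * Z')ᴴ * Λ * (Y * B i * Z')
        = (Y * B i * Z')ᴴ * (Λ * Y) * (B i * Z') := by simp only [Matrix.mul_assoc]
      _ = (G * (Z * (Y * (B i * Z'))))ᴴ * (B i * Z') := by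
          rw [← h.conjTranspose_mul]
          simp only [Matrix.conjTranspose_mul, Matrix.mul_assoc, hG.eq]
      _ = _ := by
          rw [key]
          simp only [Matrix.conjTranspose_mul, Matrix.mul_assoc, hG.eq]
  simp only [hterm]
  rw [← Matrix.sum_mul, ← Matrix.mul_sum, ← hG', h'.conjTranspose_mul, Matrix.mul_assoc,
    h'.mul_eq_one, Matrix.mul_one]

/-- Positive semidefinite Gram matrices admit a Schmidt gauge. -/
theorem exists_fin {G H : Matrix n n ℂ} (hG : G.PosSemidef) (hH : H.PosSemidef) :
    ∃ (k : ℕ) (Y : Matrix (Fin k) n ℂ) (Z : Matrix n (Fin k) ℂ) (Λ : Matrix (Fin k) (Fin k) ℂ),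
      IsSchmidtGauge G H Y Z Λ := by
  classical
  obtain ⟨T, rfl⟩ := hH.exists_eq_conjTranspose_mul_self
  obtain ⟨k, U, s, hs, hU, hM⟩ :=
    (hG.conjTranspose_mul_mul_same Tᴴ).exists_eq_isometry_mul_diagonal_mul
  rw [conjTranspose_conjTranspose] at hM
  have hsinv : diagonal s⁻¹ * diagonal s = 1 := by
    rw [diagonal_mul_diagonal, ← diagonal_one]
    congr 1
    ext j
    simp [(hs j).ne']
  have hsinv' : diagonal s * diagonal s⁻¹ = 1 := by
    rw [diagonal_mul_diagonal, ← diagonal_one]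
    congr 1
    ext j
    simp [(hs j).ne']
  have hstar : (diagonal s⁻¹)ᴴ = diagonal s⁻¹ := by
    rw [diagonal_conjTranspose]
    congr 1
    ext j
    have : star (s j) = s j := (IsSelfAdjoint.of_nonneg (hs j).le)
    simp [this]
  set Y : Matrix (Fin k) n ℂ := diagonal s⁻¹ * (Uᴴ * T * G) with hY
  have hYT : Y * Tᴴ = Uᴴ := by
    calc Y * Tᴴ = diagonal s⁻¹ * (Uᴴ * (T * G * Tᴴ)) := by
          simp only [hY, Matrix.mul_assoc]
      _ = diagonal s⁻¹ * ((Uᴴ * U) * (diagonal s * Uᴴ)) := by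
          rw [hM]; simp only [Matrix.mul_assoc]
      _ = Uᴴ := by rw [hU, Matrix.one_mul, ← Matrix.mul_assoc, hsinv, Matrix.one_mul]
  have hTY : T * Yᴴ = U := by
    rw [← conjTranspose_conjTranspose T, ← Matrix.conjTranspose_mul, hYT,
      conjTranspose_conjTranspose]
  have hGT : G * (Tᴴ * (1 - U * Uᴴ)) = 0 := by
    apply hG.mul_eq_zero_of_conjTranspose_mul_mul_eq_zero
    have : T * G * Tᴴ * (1 - U * Uᴴ) = 0 := by
      calc T * G * Tᴴ * (1 - U * Uᴴ)
          = U * (diagonal s * Uᴴ) - U * (diagonal s * (Uᴴ * U * Uᴴ)) := by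
            rw [hM, Matrix.mul_sub, Matrix.mul_one]; simp only [Matrix.mul_assoc]
        _ = 0 := by rw [hU, Matrix.one_mul, sub_self]
    rw [Matrix.conjTranspose_mul, conjTranspose_conjTranspose]
    calc _ = (1 - U * Uᴴ)ᴴ * (T * G * Tᴴ * (1 - U * Uᴴ)) := by simp only [Matrix.mul_assoc]
      _ = 0 := by rw [this, Matrix.mul_zero]
  refine ⟨k, Y, Tᴴ * U, diagonal s, ?_, ?_, ?_, ?_, isDiag_diagonal s, PosDef.diagonal hs⟩
  · rw [← Matrix.mul_assoc, hYT, hU]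
  · rw [Matrix.mul_assoc, hTY]
  · rw [Matrix.conjTranspose_mul, conjTranspose_conjTranspose, hY, ← Matrix.mul_assoc, hsinv',
      Matrix.one_mul]
  · rw [Matrix.mul_sub, Matrix.mul_one, Matrix.mul_sub, sub_eq_zero] at hGT
    calc G * (Tᴴ * U * (Y * (Tᴴ * T))) = G * (Tᴴ * (U * Uᴴ)) * T := by
          rw [← Matrix.mul_assoc Y, hYT]; simp only [Matrix.mul_assoc]
      _ = G * (Tᴴ * T) := by rw [← hGT, Matrix.mul_assoc]

/-- A Schmidt gauge which is the trivial one where the bond is already normalized. -/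
theorem exists_fin_of_fin {D : ℕ} {G H : Matrix (Fin D) (Fin D) ℂ} (hG : G.PosSemidef)
    (hH : H.PosSemidef) :
    ∃ (k : ℕ) (Y : Matrix (Fin k) (Fin D) ℂ) (Z : Matrix (Fin D) (Fin k) ℂ)
      (Λ : Matrix (Fin k) (Fin k) ℂ), IsSchmidtGauge G H Y Z Λ ∧
      (G = 1 → H = 1 → ∃ h : k = D, Y = (1 : Matrix (Fin D) (Fin D) ℂ).submatrix (Fin.cast h) id ∧
        Z = (1 : Matrix (Fin D) (Fin D) ℂ).submatrix id (Fin.cast h) ∧ Λ = 1) := by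
  by_cases h : G = 1 ∧ H = 1
  · obtain ⟨rfl, rfl⟩ := h
    refine ⟨D, 1, 1, 1, ⟨?_, ?_, ?_, ?_, isDiag_one, PosDef.one⟩, fun _ _ => ⟨rfl, rfl, rfl, rfl⟩⟩
    all_goals simp
  · obtain ⟨k, Y, Z, Λ, hYZ⟩ := exists_fin hG hH
    exact ⟨k, Y, Z, Λ, hYZ, fun h₁ h₂ => absurd ⟨h₁, h₂⟩ h⟩

end IsSchmidtGauge

section Gram

open Matrix

variable {d : ℕ} (D : ℕ → ℕ) (B : (m : ℕ) → Fin d → Matrix (Fin (D m)) (Fin (D (m + 1))) ℂ)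

/-- Gram matrix of the part of an MPS to the left of bond `m`. -/
noncomputable def leftGram : (m : ℕ) → Matrix (Fin (D m)) (Fin (D m)) ℂ
  | 0 => 1
  | m + 1 => ∑ i, (B m i)ᴴ * leftGram m * B m i

/-- Gram matrix of the `r` sites of an MPS to the right of bond `m`. -/
noncomputable def rightGram : (r m : ℕ) → Matrix (Fin (D m)) (Fin (D m)) ℂ
  | 0, _ => 1
  | r + 1, m => ∑ i, B m i * rightGram r (m + 1) * (B m i)ᴴ

theorem leftGram_posSemidef (m : ℕ) : (leftGram D B m).PosSemidef := by
  induction m with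
  | zero => exact PosSemidef.one
  | succ m ih => exact posSemidef_sum _ fun i _ => ih.conjTranspose_mul_mul_same _

theorem rightGram_posSemidef (r m : ℕ) : (rightGram D B r m).PosSemidef := by
  induction r generalizing m with
  | zero => exact PosSemidef.one
  | succ r ih => exact posSemidef_sum _ fun i _ => (ih (m + 1)).mul_mul_conjTranspose_same _

theorem trace_leftGram_mul_rightGram (r m : ℕ) :
    (leftGram D B m * rightGram D B r m).trace = (leftGram D B (m + r)).trace := by
  induction r generalizing m with
  | zero => simp [rightGram]
  | succ r ih =>
    have := ih (m + 1)
    rw [show m + (r + 1) = m + 1 + r by omega, ← this]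
    simp only [leftGram, rightGram, Matrix.mul_sum, Matrix.sum_mul, trace_sum]
    refine Finset.sum_congr rfl fun i _ => ?_
    rw [← Matrix.mul_assoc, Matrix.trace_mul_comm]
    simp only [Matrix.mul_assoc]

variable {D B}

theorem obcProd_congr {i j : ℕ → Fin d} {m : ℕ} (h : ∀ k < m, i k = j k) :
    obcProd D B i m = obcProd D B j m := by
  induction m with
  | zero => rfl
  | succ m ih =>
    simp only [obcProd]
    rw [ih fun k hk => h k (by omega), h m (by omega)]

theorem obcProd_mul_eq_zero {p : Type*} [Fintype p] (i : ℕ → Fin d) {m : ℕ}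
    {X : Matrix (Fin (D m)) p ℂ}
    (h : leftGram D B m * X = 0) : obcProd D B i m * X = 0 := by
  induction m with
  | zero => simpa [leftGram, obcProd] using h
  | succ m ih =>
    rw [obcProd, Matrix.mul_assoc]
    exact ih ((leftGram_posSemidef D B m).mul_mul_eq_zero_of_sum_mul_eq_zero h (i m))

/-- Extension of a finite configuration by a default value. -/
def extendConfig (a : Fin d) {m : ℕ} (s : Fin m → Fin d) (k : ℕ) : Fin d :=
  if h : k < m then s ⟨k, h⟩ else a

theorem leftGram_eq_sum (a : Fin d) (m : ℕ) :
    leftGram D B m = ∑ s : Fin m → Fin d,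
      (obcProd D B (extendConfig a s) m)ᴴ * obcProd D B (extendConfig a s) m := by
  induction m with
  | zero => simp [leftGram, obcProd]
  | succ m ih =>
    rw [← (Fin.snocEquiv fun _ => Fin d).sum_comp, Fintype.sum_prod_type, leftGram]
    refine Finset.sum_congr rfl fun j _ => ?_
    rw [ih, Matrix.mul_sum, Matrix.sum_mul]
    refine Finset.sum_congr rfl fun s _ => ?_
    have hlast : extendConfig a (Fin.snocEquiv (fun _ => Fin d) (j, s)) m = j := by
      simp [extendConfig, Fin.snocEquiv, Fin.snoc]
    have hinit : obcProd D B (extendConfig a (Fin.snocEquiv (fun _ => Fin d) (j, s))) m =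
        obcProd D B (extendConfig a s) m := by
      refine obcProd_congr fun k hk => ?_
      simp [extendConfig, Fin.snocEquiv, Fin.snoc, hk, Nat.lt_succ_of_lt hk]
    rw [obcProd, hlast, hinit, conjTranspose_mul]
    simp only [Matrix.mul_assoc]

theorem trace_leftGram_eq_one {N : ℕ} (hD0 : D 0 = 1) (hDN : D N = 1) (a : Fin d)
    {c : (Fin N → Fin d) → ℂ}
    (hrep : ∀ i : ℕ → Fin d, c (fun k => i k.val) = ∑ α, ∑ β, obcProd D B i N α β)
    (hnorm : ∑ i : Fin N → Fin d, ‖c i‖ ^ 2 = 1) : (leftGram D B N).trace = 1 := by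
  have : Unique (Fin (D 0)) := (finCongr hD0).unique
  have : Unique (Fin (D N)) := (finCongr hDN).unique
  have hc (s : Fin N → Fin d) :
      ((obcProd D B (extendConfig a s) N)ᴴ * obcProd D B (extendConfig a s) N).trace =
        ((‖c s‖ ^ 2 : ℝ) : ℂ) := by
    have hs : c s = ∑ α, ∑ β, obcProd D B (extendConfig a s) N α β := by
      rw [← hrep]
      congr 1
      ext k
      simp [extendConfig]
    rw [hs]
    simp only [Matrix.trace, Matrix.diag, Matrix.mul_apply, Fintype.sum_unique,
      conjTranspose_apply]
    rw [Complex.ofReal_pow, ← Complex.conj_mul']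
    rfl
  rw [leftGram_eq_sum a, trace_sum, Finset.sum_congr rfl fun s _ => hc s, ← Complex.ofReal_sum,
    hnorm, Complex.ofReal_one]

end Gram

/-- Freedom in the choice of the matrices for OBC MPS.
Given any OBC MPS representation `B` of a normalized state, there are matrices
`Y m`, `Z m` with `Y m * Z m = 1` such that the matrices
`A^{[1]}_i = B^{[1]}_i Z 1`, `A^{[m]}_i = Y (m-1) B^{[m]}_i Z m` (`1 < m < N`),
`A^{[N]}_i = Y (N-1) B^{[N]}_i` again represent the state and are in canonical form.
(Here `Y`/`Z` are 0-indexed: `Y m, Z m` connect bond `m`.) -/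
theorem stmt_1 (N d : ℕ) (hN : 0 < N)
    (Db : ℕ → ℕ) (hDb0 : Db 0 = 1) (hDbN : Db N = 1)
    (B : (m : ℕ) → Fin d → Matrix (Fin (Db m)) (Fin (Db (m + 1))) ℂ)
    (c : (Fin N → Fin d) → ℂ)
    (hrep : ∀ i : ℕ → Fin d,
      c (fun k => i k.val) = ∑ α, ∑ β, obcProd Db B i N α β)
    (hnorm : ∑ i : Fin N → Fin d, ‖c i‖ ^ 2 = 1) :
    ∃ (E : ℕ → ℕ) (hE0 : E 0 = 1) (hEN : E N = 1)
      (Y : (m : ℕ) → Matrix (Fin (E m)) (Fin (Db m)) ℂ)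
      (Z : (m : ℕ) → Matrix (Fin (Db m)) (Fin (E m)) ℂ)
      (A : (m : ℕ) → Fin d → Matrix (Fin (E m)) (Fin (E (m + 1))) ℂ)
      (Λ : (m : ℕ) → Matrix (Fin (E m)) (Fin (E m)) ℂ),
      (∀ m, 1 ≤ m → m ≤ N - 1 → Y m * Z m = 1) ∧
      (∀ i, A 0 i =
        (B 0 i * Z 1).submatrix (Fin.cast (hE0.trans hDb0.symm)) id) ∧
      (∀ m i, 1 ≤ m → m < N - 1 → A m i = Y m * B m i * Z (m + 1)) ∧
      (∀ i, A (N - 1) i =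
        (Y (N - 1) * B (N - 1) i).submatrix id
          (Fin.cast (by rw [Nat.sub_add_cancel hN, hEN, hDbN]))) ∧
      (∀ i : ℕ → Fin d,
        c (fun k => i k.val) = ∑ α, ∑ β, obcProd E A i N α β) ∧
      (∀ m, m < N → (∑ i, A m i * (A m i)ᴴ) = 1) ∧
      (∀ m, m < N → (∑ i, (A m i)ᴴ * Λ m * A m i) = Λ (m + 1)) ∧
      Λ 0 = 1 ∧ Λ N = 1 ∧
      (∀ m, 1 ≤ m → m < N →
        (Λ m).IsDiag ∧ (Λ m).PosDef ∧ (Λ m).trace = 1) := by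
  obtain ⟨n, rfl⟩ : ∃ n, N = n + 1 := ⟨N - 1, by omega⟩
  obtain ⟨a⟩ : Nonempty (Fin d) := by
    by_contra h
    rw [not_nonempty_iff] at h
    simp at hnorm
  have htrN := trace_leftGram_eq_one hDb0 hDbN a hrep hnorm
  let G := leftGram Db B
  let H := fun m => rightGram Db B (n + 1 - m) m
  have hG := leftGram_posSemidef Db B
  have hH (m : ℕ) : (H m).PosSemidef := rightGram_posSemidef Db B _ m
  have hGsucc (m : ℕ) : G (m + 1) = ∑ i, (B m i)ᴴ * G m * B m i := rfl
  have hHsucc (m : ℕ) (hm : m < n + 1) : H m = ∑ i, B m i * H (m + 1) * (B m i)ᴴ := by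
    simp only [H]
    rw [show n + 1 - m = n + 1 - (m + 1) + 1 by omega, rightGram]
  have htr (m : ℕ) (hm : m ≤ n + 1) : (G m * H m).trace = 1 := by
    rw [trace_leftGram_mul_rightGram, Nat.add_sub_cancel' hm, htrN]
  have hGN : G (n + 1) = 1 := Matrix.eq_one_of_trace_eq_one hDbN htrN
  have hHN : H (n + 1) = 1 := by simp only [H, Nat.sub_self]; rfl
  have hH0 : H 0 = 1 := Matrix.eq_one_of_trace_eq_one hDb0 (by
    rw [← htr 0 (Nat.zero_le _)]; simp [G, leftGram])
  choose E Y Z Λ hgauge htriv using fun m => IsSchmidtGauge.exists_fin_of_fin (hG m) (hH m)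
  obtain ⟨hE0, hY0, -, hΛ0⟩ := htriv 0 rfl hH0
  obtain ⟨hEN, -, hZN, hΛN⟩ := htriv (n + 1) hGN hHN
  have hprod (i : ℕ → Fin d) : obcProd E (fun m i => Y m * B m i * Z (m + 1)) i (n + 1) =
      Y 0 * obcProd Db B i (n + 1) * Z (n + 1) := by
    suffices ∀ m ≤ n + 1, obcProd E (fun m i => Y m * B m i * Z (m + 1)) i m =
        Y 0 * obcProd Db B i m * Z m from this _ le_rfl
    intro m hm
    induction m with
    | zero => simp [obcProd, (hgauge 0).mul_eq_one]
    | succ m ih =>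
      rw [obcProd, ih (by omega), obcProd]
      have hX : G m * ((Z m * Y m - 1) * ∑ i, B m i * H (m + 1) * (B m i)ᴴ) = 0 := by
        rw [← hHsucc m (by omega), Matrix.sub_mul, Matrix.mul_sub, Matrix.mul_assoc,
          (hgauge m).mul_mul_mul, Matrix.one_mul, sub_self]
      have hP := obcProd_mul_eq_zero i hX
      rw [← Matrix.mul_assoc] at hP
      have := congr($((hH (m + 1)).mul_mul_eq_zero_of_mul_sum_eq_zero hP (i m)) * (Y (m + 1))ᴴ)
      simp only [Matrix.mul_assoc, ← (hgauge (m + 1)).eq_mul_conjTranspose, Matrix.sub_mul,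
        Matrix.mul_sub, Matrix.zero_mul, Matrix.one_mul, sub_eq_zero] at this
      simp only [Matrix.mul_assoc, this]
  refine ⟨E, hE0.trans hDb0, hEN.trans hDbN, Y, Z, fun m i => Y m * B m i * Z (m + 1), Λ,
    fun m _ _ => (hgauge m).mul_eq_one, fun i => ?_, fun _ _ _ _ => rfl, fun i => ?_, fun i => ?_,
    fun m hm => (hgauge m).sum_mul_conjTranspose (hgauge (m + 1)) (hG m) (hH (m + 1)).isHermitian
      (hGsucc m) (hHsucc m hm),
    fun m hm => (hgauge m).sum_conjTranspose_mul (hgauge (m + 1)) (hG m).isHermitian (hH (m + 1))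
      (hGsucc m) (hHsucc m hm),
    hΛ0, hΛN, fun m _ hm => ⟨(hgauge m).isDiag, (hgauge m).posDef, ?_⟩⟩
  · beta_reduce
    rw [hY0, Matrix.mul_assoc]
    exact Matrix.submatrix_one_mul _ _
  · change Y n * B n i * Z (n + 1) = (Y n * B n i).submatrix id (Fin.cast hEN)
    rw [hZN]
    exact Matrix.mul_submatrix_id_one _ _
  · rw [hrep, hprod, hY0, hZN, Matrix.submatrix_one_mul, Matrix.mul_submatrix_id_one]
    exact ((finCongr hE0).sum_comp _).symm.trans
      (Finset.sum_congr rfl fun α _ => ((finCongr hEN).sum_comp _).symm)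
  · rw [(hgauge m).trace_eq (hH m).isHermitian, htr m hm.le]
end

section
/- Let ψ ∈ (ℂ^d)^{⊗N} have a TI MPS representation by D×D matrices A_i satisfying ∑_i A_i A_i† = 1 and condition C1 with parameter L_0, and let L be such that L_0 < L ≤ N and N ≥ 2L_0. Let G_L = {Γ_L(X) : X ∈ M_D(ℂ)} ⊆ (ℂ^d)^{⊗L}, let h be the orthogonal projector of (ℂ^d)^{⊗L} onto the orthogonal complement of G_L, and let H = ∑_{i=1}^N τ^i(h) where τ is the cyclic translation of the ring by one site. Then any ϕ ∈ (ℂ^d)^{⊗N} with τ^i(h)ϕ = 0 for all i is a scalar multiple of ψ; i.e., ψ is, up to normalization, the unique ground state of the frustration-free Hamiltonian H. -/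
open scoped Matrix

/-- Coefficient of a translationally invariant MPS with site-independent matrices. -/
noncomputable def tiCoeff {d D N : ℕ} (A : Fin d → Matrix (Fin D) (Fin D) ℂ)
    (i : Fin N → Fin d) : ℂ :=
  Matrix.trace (List.ofFn fun k => A (i k)).prod

theorem word_span_mono {d D : ℕ} {A : Fin d → Matrix (Fin D) (Fin D) ℂ}
    (hiso : (∑ i, A i * (A i)ᴴ) = 1) {m n : ℕ} (hmn : m ≤ n)
    (hm : Submodule.span ℂ {M | ∃ l : List (Fin d), l.length = m ∧ M = (l.map A).prod} = ⊤) :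
    Submodule.span ℂ {M | ∃ l : List (Fin d), l.length = n ∧ M = (l.map A).prod} = ⊤ := by
  induction n, hmn using Nat.le_induction with
  | base => exact hm
  | succ n _ ih =>
    have key : ∀ (i : Fin d) (M : Matrix (Fin D) (Fin D) ℂ), A i * M ∈
        Submodule.span ℂ {M | ∃ l : List (Fin d), l.length = n + 1 ∧ M = (l.map A).prod} := by
      intro i M
      have hM : M ∈ Submodule.span ℂ
          {M | ∃ l : List (Fin d), l.length = n ∧ M = (l.map A).prod} := ih ▸ Submodule.mem_top
      induction hM using Submodule.span_induction with
      | mem M hM =>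
        obtain ⟨l, hl, rfl⟩ := hM
        exact Submodule.subset_span ⟨i :: l, by simp [hl], by simp⟩
      | zero => simp
      | add x y _ _ hx hy => rw [mul_add]; exact Submodule.add_mem _ hx hy
      | smul c x _ hx => rw [mul_smul_comm]; exact Submodule.smul_mem _ c hx
    rw [eq_top_iff]
    intro M _
    have hM : M = ∑ i, A i * ((A i)ᴴ * M) := by
      simp_rw [← mul_assoc, ← Finset.sum_mul, hiso, one_mul]
    rw [hM]
    exact Submodule.sum_mem _ fun i _ => key i _

theorem eq_of_trace_mul_eq_of_span_eq_top {D : ℕ} {S : Set (Matrix (Fin D) (Fin D) ℂ)}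
    (hS : Submodule.span ℂ S = ⊤) {P Q : Matrix (Fin D) (Fin D) ℂ}
    (h : ∀ M ∈ S, Matrix.trace (P * M) = Matrix.trace (Q * M)) : P = Q := by
  rw [Matrix.ext_iff_trace_mul_right]
  intro M
  have hM : M ∈ Submodule.span ℂ S := hS ▸ Submodule.mem_top
  induction hM using Submodule.span_induction with
  | mem M hM => exact h M hM
  | zero => simp
  | add x y _ _ hx hy => simp [mul_add, hx, hy]
  | smul c x _ hx => simp [hx]

/-- Two windows of length `n` shifted by one site glue to a window of length `n + 1`. -/
theorem exists_window_succ {d D N n : ℕ} {A : Fin d → Matrix (Fin D) (Fin D) ℂ}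
    (hiso : (∑ i, A i * (A i)ᴴ) = 1)
    (hspan : Submodule.span ℂ
      {M | ∃ l : List (Fin d), l.length + 1 = n ∧ M = (l.map A).prod} = ⊤)
    {F : ℕ → List (Fin d) → ℂ}
    (hrot : ∀ t a l, l.length + 1 = N → F (t + 1) (l ++ [a]) = F t (a :: l))
    (hwin : ∀ t rest, rest.length + n = N → ∃ X : Matrix (Fin D) (Fin D) ℂ,
      ∀ l, l.length = n → F t (l ++ rest) = Matrix.trace (X * (l.map A).prod))
    (t : ℕ) (rest : List (Fin d)) (hrest : rest.length + (n + 1) = N) :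
    ∃ X : Matrix (Fin D) (Fin D) ℂ,
      ∀ l, l.length = n + 1 → F t (l ++ rest) = Matrix.trace (X * (l.map A).prod) := by
  choose X hX using fun b : Fin d => hwin t (b :: rest) (by simp; omega)
  choose Y hY using fun a : Fin d => hwin (t + 1) (rest ++ [a]) (by simp; omega)
  have hXY : ∀ a b, X b * A a = A b * Y a := by
    intro a b
    refine eq_of_trace_mul_eq_of_span_eq_top hspan ?_
    rintro _ ⟨l, hl, rfl⟩
    have h1 := hX b (a :: l) (by simpa using hl)
    have h2 := hY a (l ++ [b]) (by simpa using hl)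
    have h3 := hrot t a (l ++ b :: rest) (by simp; omega)
    simp only [List.cons_append, List.append_assoc, List.nil_append, List.map_cons,
      List.map_append, List.map_nil, List.prod_cons, List.prod_append, List.prod_nil,
      mul_one] at h1 h2 h3
    rw [mul_assoc, ← h1, ← h3, h2, mul_assoc (A b), Matrix.trace_mul_comm (A b), mul_assoc]
  have hXZ : ∀ b, X b = A b * ∑ a, Y a * (A a)ᴴ := by
    intro b
    rw [Finset.mul_sum]
    simp_rw [← mul_assoc, ← hXY, mul_assoc, ← Finset.mul_sum, hiso, mul_one]
  refine ⟨∑ a, Y a * (A a)ᴴ, fun l hl => ?_⟩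
  obtain ⟨l', b, rfl⟩ := List.eq_nil_or_concat l |>.resolve_left (by rintro rfl; simp at hl)
  have h := hX b l' (by simpa using hl)
  simp only [List.concat_eq_append, List.append_assoc, List.cons_append, List.nil_append,
    List.map_append, List.map_cons, List.map_nil, List.prod_append, List.prod_cons,
    List.prod_nil, mul_one]
  rw [h, hXZ, mul_assoc, Matrix.trace_mul_comm, mul_assoc]

theorem exists_eq_smul_of_windows {d D N L0 L : ℕ} {A : Fin d → Matrix (Fin D) (Fin D) ℂ}
    (hiso : (∑ i, A i * (A i)ᴴ) = 1)
    (hC1 : Submodule.span ℂ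
      {M | ∃ l : List (Fin d), l.length = L0 ∧ M = (l.map A).prod} = ⊤)
    (hL : L0 < L) (hLN : L ≤ N) (hN : 2 * L0 ≤ N) {F : ℕ → List (Fin d) → ℂ}
    (hrot : ∀ t a l, l.length + 1 = N → F (t + 1) (l ++ [a]) = F t (a :: l))
    (hwin : ∀ t rest, rest.length + L = N → ∃ X : Matrix (Fin D) (Fin D) ℂ,
      ∀ l, l.length = L → F t (l ++ rest) = Matrix.trace (X * (l.map A).prod)) :
    ∃ z : ℂ, ∀ l, l.length = N → F 0 l = z * Matrix.trace (l.map A).prod := by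
  have hall : ∀ n, L ≤ n → n ≤ N → ∀ t rest, rest.length + n = N →
      ∃ X : Matrix (Fin D) (Fin D) ℂ,
        ∀ l, l.length = n → F t (l ++ rest) = Matrix.trace (X * (l.map A).prod) := by
    intro n hn
    induction n, hn using Nat.le_induction with
    | base => exact fun _ => hwin
    | succ n hn ih =>
      intro hnN
      obtain ⟨m, rfl⟩ : ∃ m, n = m + 1 := ⟨n - 1, by omega⟩
      refine exists_window_succ hiso ?_ hrot (ih (by omega))
      simpa using word_span_mono hiso (n := m) (by omega) hC1
  have hrots : ∀ (u w : List (Fin d)) (t : ℕ), u.length + w.length = N →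
      F (t + u.length) (w ++ u) = F t (u ++ w) := by
    intro u
    induction u with
    | nil => simp
    | cons a u ih =>
      intro w t h
      simp only [List.length_cons] at h
      have h1 := ih (w ++ [a]) (t + 1) (by simp; omega)
      have h2 := hrot t a (u ++ w) (by simp; omega)
      simp only [List.append_assoc, List.cons_append, List.nil_append] at h1 h2
      rw [List.length_cons, add_comm u.length 1, ← add_assoc, h1, h2, List.cons_append]
  obtain ⟨X, hX⟩ := hall N hLN le_rfl 0 [] (by simp)
  obtain ⟨Y, hY⟩ := hall N hLN le_rfl L0 [] (by simp)
  simp only [List.append_nil] at hX hY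
  have hspan := word_span_mono hiso (n := N - L0) (by omega) hC1
  have hword : ∀ U ∈ {M | ∃ l : List (Fin d), l.length = L0 ∧ M = (l.map A).prod},
      X * U = U * Y := by
    rintro _ ⟨u, hu, rfl⟩
    refine eq_of_trace_mul_eq_of_span_eq_top hspan ?_
    rintro _ ⟨w, hw, rfl⟩
    have h := hrots u w 0 (by omega)
    rw [zero_add, hu, hX _ (by simp; omega), hY _ (by simp; omega)] at h
    simp only [List.map_append, List.prod_append] at h
    rw [mul_assoc, ← h, mul_assoc, Matrix.trace_mul_comm (u.map A).prod, ← mul_assoc]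
  have hcomm : ∀ U, X * U = U * Y := by
    intro U
    have hU : U ∈ Submodule.span ℂ
        {M | ∃ l : List (Fin d), l.length = L0 ∧ M = (l.map A).prod} :=
      hC1 ▸ Submodule.mem_top
    induction hU using Submodule.span_induction with
    | mem M hM => exact hword M hM
    | zero => simp
    | add x y _ _ hx hy => simp [mul_add, add_mul, hx, hy]
    | smul c x _ hx => simp [hx]
  have hXY : X = Y := by simpa using hcomm 1
  subst hXY
  obtain ⟨z, hz⟩ : X ∈ Set.range (Matrix.scalar (Fin D)) :=
    Matrix.mem_range_scalar_iff_commute_single'.2 fun i j => (hcomm _).symm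
  refine ⟨z, fun l hl => ?_⟩
  rw [hX l hl, ← hz, Matrix.scalar_apply, ← Matrix.smul_eq_diagonal_mul]
  simp

/-- The coefficient of `ϕ` at the configuration reading `l` cyclically from site `t` onwards,
and `0` if `l` does not have length `N`. -/
noncomputable def cyclicCoeff {d N : ℕ} [NeZero N] (ϕ : (Fin N → Fin d) → ℂ) (t : ℕ)
    (l : List (Fin d)) : ℂ :=
  if h : l.length = N then ϕ fun k => l.get ((k - Fin.ofNat N t).cast h.symm) else 0

theorem cyclicCoeff_succ_append {d N : ℕ} [NeZero N] (ϕ : (Fin N → Fin d) → ℂ) (t : ℕ)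
    (a : Fin d) (l : List (Fin d)) (hl : l.length + 1 = N) :
    cyclicCoeff ϕ (t + 1) (l ++ [a]) = cyclicCoeff ϕ t (a :: l) := by
  subst hl
  simp only [cyclicCoeff, List.length_append, List.length_cons, List.length_nil, zero_add,
    dif_pos]
  congr 1
  funext k
  have hk : k - Fin.ofNat (l.length + 1) (t + 1) = k - Fin.ofNat (l.length + 1) t - 1 := by
    rw [sub_sub]
    congr 1
    ext
    simp [Fin.val_add]
  rw [hk]
  generalize k - Fin.ofNat (l.length + 1) t = m
  induction m using Fin.cases with
  | zero =>
    have h0 : ((0 : Fin (l.length + 1)) - 1) = Fin.last _ := by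
      rw [sub_eq_iff_eq_add, Fin.last_add_one]
    rw [h0]
    simp
  | succ m =>
    have h1 : m.succ - 1 = m.castSucc := by
      rw [sub_eq_iff_eq_add, Fin.coeSucc_eq_succ]
    rw [h1]
    simp

/-- Uniqueness of the ground state with TI and PBC.  Let `ψ`
be the TI MPS generated by matrices `A` with `∑ᵢ AᵢAᵢᴴ = 1` satisfying condition
C1 with parameter `L0`, and let `L0 < L ≤ N`, `N ≥ 2 L0`.  If every cyclic window
of `L` consecutive sites of a state `ϕ` lies in `G_L = {Γ_L(X)}` (i.e.
`τ^t(h) ϕ = 0` for the projector `h` onto `G_L^⊥` and every translate `t`), then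
`ϕ` is proportional to `ψ`: `ψ` is the unique ground state of `H_{G_L}`. -/
theorem stmt_10 (N d D L0 L : ℕ)
    (A : Fin d → Matrix (Fin D) (Fin D) ℂ)
    (hiso : (∑ i, A i * (A i)ᴴ) = 1)
    (hC1 : Submodule.span ℂ
      {M : Matrix (Fin D) (Fin D) ℂ |
        ∃ i : Fin L0 → Fin d, M = (List.ofFn fun k => A (i k)).prod} = ⊤)
    (hL : L0 < L) (hLN : L ≤ N) (hN : 2 * L0 ≤ N)
    (ϕ : (Fin N → Fin d) → ℂ)
    (hground : ∀ (t : Fin N) (rest : Fin (N - L) → Fin d),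
      ∃ X : Matrix (Fin D) (Fin D) ℂ,
        ∀ a : Fin L → Fin d,
          ϕ (fun k => Fin.append a rest (Fin.cast (by omega) (k - t))) =
            Matrix.trace (X * (List.ofFn fun r => A (a r)).prod)) :
    ∃ z : ℂ, ∀ i : Fin N → Fin d, ϕ i = z * tiCoeff A i := by
  have : NeZero N := ⟨by omega⟩
  have hofFn : ∀ {n : ℕ} (i : Fin n → Fin d),
      (List.ofFn fun k => A (i k)) = (List.ofFn i).map A := fun i => by
    rw [List.map_ofFn]; rfl
  have hwords : {M : Matrix (Fin D) (Fin D) ℂ |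
        ∃ i : Fin L0 → Fin d, M = (List.ofFn fun k => A (i k)).prod} =
      {M | ∃ l : List (Fin d), l.length = L0 ∧ M = (l.map A).prod} := by
    ext M
    constructor
    · rintro ⟨i, rfl⟩
      exact ⟨List.ofFn i, by simp, by rw [hofFn]⟩
    · rintro ⟨l, rfl, rfl⟩
      exact ⟨l.get, by rw [hofFn, List.ofFn_get]⟩
  rw [hwords] at hC1
  obtain ⟨z, hz⟩ := exists_eq_smul_of_windows hiso hC1 hL hLN hN
    (F := cyclicCoeff ϕ) (cyclicCoeff_succ_append ϕ) (by
      intro t rest hrest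
      obtain rfl : N = rest.length + L := hrest.symm
      obtain ⟨X, hX⟩ := hground (Fin.ofNat _ t) (fun k => rest.get (k.cast (by omega)))
      refine ⟨X, fun l hl => ?_⟩
      subst hl
      have h := hX l.get
      rw [hofFn, List.ofFn_get] at h
      rw [← h, cyclicCoeff, dif_pos (by simp [add_comm])]
      congr 1
      funext k
      generalize k - Fin.ofNat _ t = m
      by_cases hm : m.val < l.length
      · have : Fin.cast (by omega) m =
            Fin.castAdd (rest.length + l.length - l.length) ⟨m.val, hm⟩ := rfl
        rw [this, Fin.append_left]
        simp [List.getElem_append_left, hm]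
      · have : Fin.cast (by omega) m =
            Fin.natAdd l.length (⟨m.val - l.length, by omega⟩ :
              Fin (rest.length + l.length - l.length)) := by
          ext; simp; omega
        rw [this, Fin.append_right]
        simp [List.getElem_append_right (Nat.le_of_not_lt hm)])
  refine ⟨z, fun i => ?_⟩
  rw [tiCoeff, hofFn, ← hz (List.ofFn i) (by simp), cyclicCoeff, dif_pos (by simp)]
  congr 1
  funext k
  simp
end

section
/- Let A^1,…,A^b be families of matrices (A^j_i of size D_j × D_j, i = 1,…,d), each in single-block canonical form and each satisfying condition C1 with common parameter L_0, and suppose the normalized TI MPS states generated by distinct families on a ring of N sites are pairwise different. Then for every L with 3(b−1)(L_0+1) ≤ L ≤ N, the subspaces G_L^{A^1},…,G_L^{A^b} of (ℂ^d)^{⊗L} form a direct sum: if w_j ∈ G_L^{A^j} for each j and ∑_{j=1}^b w_j = 0, then w_j = 0 for all j. -/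
open scoped Matrix ComplexOrder

namespace MPSDirectSum

/-- A functional on a matrix algebra that vanishes on commutators is a multiple of the trace. -/
lemma exists_eq_smul_trace {K n : Type*} [Field K] [Fintype n] [DecidableEq n]
    (f : Matrix n n K →ₗ[K] K) (hf : ∀ X Y, f (X * Y) = f (Y * X)) :
    ∃ z : K, ∀ X, f X = z * X.trace := by
  rcases isEmpty_or_nonempty n with h | ⟨⟨a⟩⟩
  · exact ⟨0, fun X => by rw [Subsingleton.elim X 0]; simp⟩
  · refine ⟨f (Matrix.single a a 1), fun X => ?_⟩
    have h : f = f (Matrix.single a a 1) • Matrix.traceLinearMap n K K := by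
      refine Matrix.ext_linearMap K fun i j => LinearMap.ext_ring ?_
      have h1 := hf (Matrix.single i a 1) (Matrix.single a j 1)
      rw [Matrix.single_mul_single_same] at h1
      rcases eq_or_ne i j with rfl | hij
      · simpa using h1
      · rw [Matrix.single_mul_single_of_ne _ _ _ _ hij.symm] at h1
        simpa [Matrix.trace_single_eq_of_ne _ _ _ hij] using h1
    simpa using LinearMap.congr_fun h X

/-- The two-sided ideal generated by a nonzero matrix is everything. -/
lemma submodule_eq_top_of_mul_mul_mem {K n : Type*} [Field K] [Fintype n] [DecidableEq n]
    {U : Submodule K (Matrix n n K)} {Y : Matrix n n K} (hY : Y ≠ 0)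
    (hU : ∀ X Z, X * Y * Z ∈ U) : U = ⊤ := by
  obtain ⟨a, b, hab⟩ : ∃ a b, Y a b ≠ 0 := by
    by_contra! h
    exact hY (Matrix.ext h)
  refine eq_top_iff.2 fun M _ => ?_
  rw [Matrix.matrix_eq_sum_single M]
  refine Submodule.sum_mem _ fun i _ => Submodule.sum_mem _ fun j _ => ?_
  have h := U.smul_mem (M i j * (Y a b)⁻¹)
    (hU (Matrix.single i a 1) (Matrix.single b j 1))
  rwa [Matrix.single_mul_mul_single, Matrix.smul_single, one_mul, mul_one, smul_eq_mul,
    mul_assoc, inv_mul_cancel₀ hab, mul_one] at h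

section Lift

variable {K R M₁ M₂ ι : Type*} [Field K] [Ring R] [Algebra K R] [Ring M₁] [Algebra K M₁]
  [Ring M₂] [Algebra K M₂] [Fintype ι]

lemma map_span_pow_eq_top_of_le (p : R →ₐ[K] M₁) {a : ι → R} {c : ι → M₁}
    (hc : ∑ i, p (a i) * c i = 1) {k l : ℕ} (hkl : k ≤ l)
    (hk : (Submodule.span K (Set.range a) ^ k).map p.toLinearMap = ⊤) :
    (Submodule.span K (Set.range a) ^ l).map p.toLinearMap = ⊤ := by
  induction l, hkl using Nat.le_induction with
  | base => exact hk
  | succ l _ ih =>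
    refine eq_top_iff.2 fun X _ => ?_
    rw [pow_succ', Submodule.map_mul, ih, ← one_mul X, ← hc, Finset.sum_mul]
    refine Submodule.sum_mem _ fun i _ => ?_
    rw [mul_assoc]
    exact Submodule.mul_mem_mul (Submodule.mem_map_of_mem
      (Submodule.subset_span ⟨i, rfl⟩)) Submodule.mem_top

/-- On `V ^ k`, the value of `q` is a linear function of the value of `p`. -/
def Factors (p : R →ₐ[K] M₁) (q : R →ₐ[K] M₂) (V : Submodule K R) (k : ℕ) : Prop :=
  ∃ φ : M₁ →ₗ[K] M₂, ∀ s ∈ V ^ k, φ (p s) = q s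

variable {p : R →ₐ[K] M₁} {q : R →ₐ[K] M₂} {a : ι → R} {c : ι → M₁} {c' : ι → M₂}

lemma factors_of_forall_eq_zero {V : Submodule K R} {k : ℕ}
    (h : ∀ s ∈ V ^ k, p s = 0 → q s = 0) : Factors p q V k := by
  let P := p.toLinearMap ∘ₗ (V ^ k).subtype
  let Q := q.toLinearMap ∘ₗ (V ^ k).subtype
  have hPQ : LinearMap.ker P ≤ LinearMap.ker Q := fun s hs => h s s.2 hs
  obtain ⟨φ, hφ⟩ := LinearMap.exists_extend
    ((LinearMap.ker P).liftQ Q hPQ ∘ₗ P.quotKerEquivRange.symm.toLinearMap)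
  refine ⟨φ, fun s hs => ?_⟩
  have h1 := LinearMap.congr_fun hφ (P.rangeRestrict ⟨s, hs⟩)
  have h2 : P.quotKerEquivRange.symm (P.rangeRestrict ⟨s, hs⟩) =
      (LinearMap.ker P).mkQ ⟨s, hs⟩ := by
    rw [LinearEquiv.symm_apply_eq]
    rfl
  simp only [LinearMap.comp_apply, LinearEquiv.coe_coe, h2] at h1
  exact h1

lemma Factors.of_succ (hc' : ∑ i, q (a i) * c' i = 1) {k : ℕ}
    (h : Factors p q (Submodule.span K (Set.range a)) (k + 1)) :
    Factors p q (Submodule.span K (Set.range a)) k := by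
  obtain ⟨φ, hφ⟩ := h
  refine ⟨∑ i, LinearMap.mulRight K (c' i) ∘ₗ φ ∘ₗ LinearMap.mulRight K (p (a i)),
    fun s hs => ?_⟩
  have h1 (i) : φ (p s * p (a i)) = q s * q (a i) := by
    rw [← map_mul, ← map_mul, hφ]
    rw [pow_succ]
    exact Submodule.mul_mem_mul hs (Submodule.subset_span ⟨i, rfl⟩)
  simp [h1, mul_assoc, ← Finset.mul_sum, hc']

lemma Factors.add_two (hc : ∑ i, p (a i) * c i = 1) {k : ℕ}
    (htop : (Submodule.span K (Set.range a) ^ k).map p.toLinearMap = ⊤)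
    (h : Factors p q (Submodule.span K (Set.range a)) k)
    (h' : Factors p q (Submodule.span K (Set.range a)) (k + 1)) :
    Factors p q (Submodule.span K (Set.range a)) (k + 2) := by
  set V := Submodule.span K (Set.range a) with hV
  have haV (i) : a i ∈ V := Submodule.subset_span ⟨i, rfl⟩
  obtain ⟨φ, hφ⟩ := h
  obtain ⟨ψ, hψ⟩ := h'
  have hlift (X : M₁) : ∃ s ∈ V ^ k, p s = X := by
    have : X ∈ (V ^ k).map p.toLinearMap := htop ▸ Submodule.mem_top
    exact this
  have hl (i X) : ψ (p (a i) * X) = q (a i) * φ X := by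
    obtain ⟨s, hs, rfl⟩ := hlift X
    rw [hφ s hs, ← map_mul, ← map_mul, hψ]
    rw [pow_succ']
    exact Submodule.mul_mem_mul (haV i) hs
  have hr (X i) : ψ (X * p (a i)) = φ X * q (a i) := by
    obtain ⟨s, hs, rfl⟩ := hlift X
    rw [hφ s hs, ← map_mul, ← map_mul, hψ]
    rw [pow_succ]
    exact Submodule.mul_mem_mul hs (haV i)
  have hsum (X) : ∑ i, q (a i) * φ (c i * X) = ψ X := by
    simp_rw [← hl, ← map_sum, ← mul_assoc, ← Finset.sum_mul, hc, one_mul]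
  refine ⟨∑ i, LinearMap.mulLeft K (q (a i)) ∘ₗ ψ ∘ₗ LinearMap.mulLeft K (c i),
    fun s hs => ?_⟩
  rw [pow_succ] at hs
  induction hs using Submodule.mul_induction_on' with
  | add x _ y _ hx hy => rw [map_add, map_add, map_add, hx, hy]
  | mem_mul_mem t ht x hx =>
    induction hx using Submodule.span_induction with
    | mem x hx =>
      obtain ⟨i, rfl⟩ := hx
      simp only [LinearMap.sum_apply, LinearMap.comp_apply, LinearMap.mulLeft_apply, map_mul]
      simp_rw [← mul_assoc (c _), hr, ← mul_assoc (q (a _)), ← Finset.sum_mul, hsum, hψ t ht]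
    | zero => simp
    | add x y _ _ hx hy => rw [mul_add, map_add, map_add, map_add, hx, hy]
    | smul z x _ hx => rw [mul_smul_comm, map_smul, map_smul, map_smul, hx]

lemma Factors.of_le (hc : ∑ i, p (a i) * c i = 1) (hc' : ∑ i, q (a i) * c' i = 1) {k l : ℕ}
    (htop : (Submodule.span K (Set.range a) ^ k).map p.toLinearMap = ⊤)
    (h : Factors p q (Submodule.span K (Set.range a)) (k + 1)) (hkl : k ≤ l) :
    Factors p q (Submodule.span K (Set.range a)) l := by
  suffices Factors p q (Submodule.span K (Set.range a)) (l + 1) from this.of_succ hc'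
  induction l, hkl using Nat.le_induction with
  | base => exact h
  | succ l hl ih =>
    exact Factors.add_two hc (map_span_pow_eq_top_of_le p hc hl htop) (ih.of_succ hc') ih

end Lift

section Matrices

variable {K R ι m n : Type*} [Field K] [Ring R] [Algebra K R] [Fintype ι]
  [Fintype m] [DecidableEq m] [Fintype n] [DecidableEq n]
  {p : R →ₐ[K] Matrix m m K} {q : R →ₐ[K] Matrix n n K}

lemma Factors.exists_trace_eq {V : Submodule K R} {k l : ℕ} (hk : Factors p q V k)
    (hl : Factors p q V l) (hkl : Factors p q V (k + l))
    (hktop : (V ^ k).map p.toLinearMap = ⊤) (hltop : (V ^ l).map p.toLinearMap = ⊤) :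
    ∃ z : K, ∀ s ∈ V ^ (k + l), (q s).trace = z * (p s).trace := by
  obtain ⟨φ, hφ⟩ := hkl
  have lift {j} (hj : (V ^ j).map p.toLinearMap = ⊤) (X) : ∃ s ∈ V ^ j, p s = X := by
    have : X ∈ (V ^ j).map p.toLinearMap := hj ▸ Submodule.mem_top
    exact this
  obtain ⟨z, hz⟩ := exists_eq_smul_trace (Matrix.traceLinearMap n K K ∘ₗ φ) (fun X Y => by
    obtain ⟨φk, hφk⟩ := hk
    obtain ⟨φl, hφl⟩ := hl
    have hXY (X Y) : φ (X * Y) = φk X * φl Y := by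
      obtain ⟨s, hs, rfl⟩ := lift hktop X
      obtain ⟨t, ht, rfl⟩ := lift hltop Y
      rw [hφk s hs, hφl t ht, ← map_mul, ← map_mul, hφ]
      rw [pow_add]
      exact Submodule.mul_mem_mul hs ht
    have hYX (X Y) : φ (Y * X) = φl Y * φk X := by
      obtain ⟨s, hs, rfl⟩ := lift hktop X
      obtain ⟨t, ht, rfl⟩ := lift hltop Y
      rw [hφk s hs, hφl t ht, ← map_mul, ← map_mul, hφ]
      rw [add_comm, pow_add]
      exact Submodule.mul_mem_mul ht hs
    simp only [LinearMap.comp_apply, Matrix.traceLinearMap_apply, hXY X Y, hYX X Y]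
    exact Matrix.trace_mul_comm _ _)
  refine ⟨z, fun s hs => ?_⟩
  rw [← hz, ← hφ s hs]
  rfl

lemma exists_eq_zero_and_eq_of_not_factors {V : Submodule K R} {k l : ℕ}
    (hktop : (V ^ k).map q.toLinearMap = ⊤) (h : ¬ Factors p q V l) (Y : Matrix n n K) :
    ∃ s ∈ V ^ (k + l + k), p s = 0 ∧ q s = Y := by
  obtain ⟨s, hs, hps, hqs⟩ : ∃ s ∈ V ^ l, p s = 0 ∧ q s ≠ 0 := by
    by_contra! h'
    exact h (factors_of_forall_eq_zero h')
  have lift (X) : ∃ s ∈ V ^ k, q s = X := by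
    have : X ∈ (V ^ k).map q.toLinearMap := hktop ▸ Submodule.mem_top
    exact this
  have htop : (V ^ (k + l + k) ⊓ LinearMap.ker p.toLinearMap).map q.toLinearMap = ⊤ := by
    refine submodule_eq_top_of_mul_mul_mem hqs fun X Z => ?_
    obtain ⟨x, hx, rfl⟩ := lift X
    obtain ⟨z, hz, rfl⟩ := lift Z
    refine ⟨x * s * z, ⟨?_, ?_⟩, by simp⟩
    · rw [pow_add, pow_add]
      exact Submodule.mul_mem_mul (Submodule.mul_mem_mul hx hs) hz
    · simp [hps]
  obtain ⟨t, ⟨ht, hpt⟩, hqt⟩ : Y ∈ (V ^ (k + l + k) ⊓ LinearMap.ker p.toLinearMap).map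
      q.toLinearMap := htop ▸ Submodule.mem_top
  exact ⟨t, ht, hpt, hqt⟩

end Matrices

section Pi

variable {K J ι : Type*} [Field K] [Fintype ι] {M : J → Type*} [∀ j, Ring (M j)]
  [∀ j, Algebra K (M j)] {a : ι → ∀ j, M j}

lemma exists_mem_pow_of_le {j : J} {c : ι → M j} (hc : ∑ i, a i j * c i = 1) {P : J → Prop}
    {k l : ℕ} (hkl : k ≤ l)
    (h : ∀ Y, ∃ s ∈ Submodule.span K (Set.range a) ^ k, s j = Y ∧ ∀ i, P i → s i = 0) (Y : M j) :
    ∃ s ∈ Submodule.span K (Set.range a) ^ l, s j = Y ∧ ∀ i, P i → s i = 0 := by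
  induction l, hkl using Nat.le_induction generalizing Y with
  | base => exact h Y
  | succ l _ ih =>
    choose s hs hsY hs0 using fun i => ih (c i * Y)
    refine ⟨∑ i, a i * s i, ?_, ?_, fun i hi => ?_⟩
    · rw [pow_succ']
      exact Submodule.sum_mem _ fun i _ =>
        Submodule.mul_mem_mul (Submodule.subset_span ⟨i, rfl⟩) (hs i)
    · simp [hsY, ← mul_assoc, ← Finset.sum_mul, hc]
    · simp [hs0 _ i hi]

lemma exists_mem_pow_card_mul {V : Submodule K (∀ j, M j)} {j : J} {k : ℕ} {T : Finset J}
    (hT : T.Nonempty)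
    (h : ∀ i ∈ T, ∀ Y, ∃ s ∈ V ^ k, s i = 0 ∧ s j = Y) (Y : M j) :
    ∃ s ∈ V ^ (T.card * k), s j = Y ∧ ∀ i, i ∈ T → s i = 0 := by
  induction hT using Finset.Nonempty.cons_induction generalizing Y with
  | singleton i =>
    obtain ⟨s, hs, h0, hY⟩ := h i (Finset.mem_singleton_self i) Y
    exact ⟨s, by simpa using hs, hY, by simpa using h0⟩
  | cons i T hi hT ih =>
    obtain ⟨s, hs, h0, hY⟩ := h i (Finset.mem_cons_self i T) Y
    obtain ⟨t, ht, ht1, ht0⟩ := ih (fun i hi => h i (Finset.mem_cons_of_mem hi)) 1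
    refine ⟨t * s, ?_, by simp [ht1, hY], fun i' hi' => ?_⟩
    · rw [Finset.card_cons, add_mul, one_mul, pow_add]
      exact Submodule.mul_mem_mul ht hs
    · rcases Finset.mem_cons.1 hi' with rfl | hi'
      · simp [h0]
      · simp [ht0 i' hi']

end Pi

lemma span_range_pow {K R ι : Type*} [CommSemiring K] [Semiring R] [Algebra K R] (a : ι → R)
    (n : ℕ) : Submodule.span K (Set.range a) ^ n =
      Submodule.span K {M | ∃ i : Fin n → ι, M = (List.ofFn fun k => a (i k)).prod} := by
  rw [Submodule.span_pow]
  congr 1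
  ext x
  rw [Set.mem_pow]
  constructor
  · rintro ⟨f, rfl⟩
    choose i hi using fun k => (f k).2
    exact ⟨i, by simp [hi]⟩
  · rintro ⟨i, rfl⟩
    exact ⟨fun k => ⟨a (i k), i k, rfl⟩, rfl⟩

end MPSDirectSum

/-- The sum `⊕ⱼ G_L^{Aʲ}` is direct.  Let `A¹, …, A^b` be
families of matrices, each in single-block canonical form, each satisfying
condition C1 with parameter `L0`, generating pairwise different (non-proportional)
TI MPS states on the ring of `N` sites.  Then for any `L` with
`3(b-1)(L0+1) ≤ L ≤ N`, elements `w j ∈ G_L^{Aʲ}` with `∑ⱼ w j = 0` all vanish. -/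
theorem stmt_12 (N d b L0 : ℕ)
    (Ds : Fin b → ℕ)
    (A : (j : Fin b) → Fin d → Matrix (Fin (Ds j)) (Fin (Ds j)) ℂ)
    (Λ : (j : Fin b) → Matrix (Fin (Ds j)) (Fin (Ds j)) ℂ)
    (hiso : ∀ j, (∑ i, A j i * (A j i)ᴴ) = 1)
    (hΛ : ∀ j, (Λ j).IsDiag ∧ (Λ j).PosDef ∧
      (∑ i, (A j i)ᴴ * Λ j * A j i) = Λ j)
    (hfix : ∀ j (X : Matrix (Fin (Ds j)) (Fin (Ds j)) ℂ),
      (∑ i, A j i * X * (A j i)ᴴ) = X → ∃ z : ℂ, X = z • 1)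
    (hC1 : ∀ j, Submodule.span ℂ
      {M : Matrix (Fin (Ds j)) (Fin (Ds j)) ℂ |
        ∃ i : Fin L0 → Fin d, M = (List.ofFn fun k => A j (i k)).prod} = ⊤)
    (hdiff : ∀ j j', j ≠ j' →
      ¬ ∃ z : ℂ, ∀ i : Fin N → Fin d, tiCoeff (A j) i = z * tiCoeff (A j') i)
    (L : ℕ) (hL1 : 3 * (b - 1) * (L0 + 1) ≤ L) (hL2 : L ≤ N)
    (w : Fin b → (Fin L → Fin d) → ℂ)
    (hw : ∀ j, ∃ X : Matrix (Fin (Ds j)) (Fin (Ds j)) ℂ,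
      ∀ i : Fin L → Fin d,
        w j i = Matrix.trace (X * (List.ofFn fun k => A j (i k)).prod))
    (hsum : ∑ j, w j = 0) :
    ∀ j, w j = 0 := by
  intro j₀
  choose X hX using hw
  let V := Submodule.span ℂ (Set.range fun i j => A j i)
  let p (j : Fin b) := Pi.evalAlgHom ℂ (fun j => Matrix (Fin (Ds j)) (Fin (Ds j)) ℂ) j
  have hword (j : Fin b) {n : ℕ} (i : Fin n → Fin d) :
      (List.ofFn fun k j => A j (i k)).prod j = (List.ofFn fun k => A j (i k)).prod := by
    simpa [p, List.map_ofFn, Function.comp_def] using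
      map_list_prod (p j) (List.ofFn fun k j => A j (i k))
  have htop (j : Fin b) {k : ℕ} (hk : L0 ≤ k) : (V ^ k).map (p j).toLinearMap = ⊤ := by
    refine MPSDirectSum.map_span_pow_eq_top_of_le (p j) (hiso j) hk ?_
    rw [Submodule.map_pow, Submodule.map_span, ← Set.range_comp, ← hC1 j]
    exact MPSDirectSum.span_range_pow _ _
  rcases Nat.lt_or_ge b 2 with hb | hb
  · have : Subsingleton (Fin b) := Fin.subsingleton_iff_le_one.2 (by omega)
    rw [← hsum, Fintype.sum_subsingleton _ j₀]
  have hL : (b - 1) * (3 * L0 + 3) ≤ L := le_trans (by ring_nf; rfl) hL1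
  have hLmul : 3 * L0 + 3 ≤ (b - 1) * (3 * L0 + 3) :=
    Nat.le_mul_of_pos_left _ (by omega)
  have hnot (i j : Fin b) (hij : i ≠ j) : ¬ MPSDirectSum.Factors (p i) (p j) V (L0 + 1) := by
    intro h
    have hall {k : ℕ} (hk : L0 ≤ k) : MPSDirectSum.Factors (p i) (p j) V k :=
      MPSDirectSum.Factors.of_le (p := p i) (q := p j) (a := fun i j => A j i)
        (c := fun k => (A i k)ᴴ) (c' := fun k => (A j k)ᴴ) (hiso i) (hiso j) (htop i le_rfl) h hk
    obtain ⟨z, hz⟩ := MPSDirectSum.Factors.exists_trace_eq (k := L0) (l := N - L0)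
      (hall le_rfl) (hall (by omega)) (hall (by omega)) (htop i le_rfl) (htop i (by omega))
    rw [Nat.add_sub_cancel' (by omega)] at hz
    refine hdiff j i hij.symm ⟨z, fun i' => ?_⟩
    have h1 := hz _ ((MPSDirectSum.span_range_pow _ N).ge (Submodule.subset_span ⟨i', rfl⟩))
    simpa only [p, Pi.evalAlgHom_apply, hword, tiCoeff] using h1
  have hcard : (Finset.univ.erase j₀).card = b - 1 := by simp
  have hne : (Finset.univ.erase j₀).Nonempty := Finset.card_pos.1 (by omega)
  have hle : (Finset.univ.erase j₀).card * (L0 + (L0 + 1) + L0) ≤ L := by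
    rw [hcard]
    exact le_trans (Nat.mul_le_mul_left _ (by omega)) hL
  have hfun (s) (hs : s ∈ V ^ L) : ∑ j, (X j * s j).trace = 0 := by
    rw [MPSDirectSum.span_range_pow] at hs
    induction hs using Submodule.span_induction with
    | mem x hx =>
      obtain ⟨i, rfl⟩ := hx
      simpa [hword, hX] using congrFun hsum i
    | zero => simp
    | add x y _ _ hx hy => simp [mul_add, Finset.sum_add_distrib, hx, hy]
    | smul c x _ hx => simp [← Finset.mul_sum, hx]
  have hX0 : X j₀ = 0 := by
    refine Matrix.ext_iff_trace_mul_right.2 fun Y => ?_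
    obtain ⟨s, hs, hsY, hs0⟩ := MPSDirectSum.exists_mem_pow_of_le (K := ℂ)
      (M := fun j => Matrix (Fin (Ds j)) (Fin (Ds j)) ℂ) (j := j₀) (a := fun i j => A j i)
      (c := fun k => (A j₀ k)ᴴ) (hiso j₀) (P := fun i => i ∈ Finset.univ.erase j₀) hle
      (MPSDirectSum.exists_mem_pow_card_mul (K := ℂ) (V := V) (j := j₀)
        (M := fun j => Matrix (Fin (Ds j)) (Fin (Ds j)) ℂ) (k := L0 + (L0 + 1) + L0) hne fun i hi =>
        MPSDirectSum.exists_eq_zero_and_eq_of_not_factors (p := p i) (q := p j₀)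
          (htop j₀ le_rfl) (hnot i j₀ (Finset.ne_of_mem_erase hi))) Y
    have h := hfun s hs
    rw [Finset.sum_eq_single j₀ (fun i _ hi => by
      rw [hs0 i (Finset.mem_erase.2 ⟨hi, Finset.mem_univ i⟩)]; simp) (by simp), hsY] at h
    simpa using h
  funext i
  simp [hX, hX0]
end

section
/- Let ψ = ∑_{j=1}^b ψ_{A^j} ∈ (ℂ^d)^{⊗N}, where b ≥ 2, each ψ_{A^j} is the TI MPS state with coefficients λ_j^N tr(A^j_{i_1}⋯A^j_{i_N}) with λ_j > 0, the families A^j are in single-block canonical form, each satisfies condition C1 with parameter L_0, and the states ψ_{A^j} are pairwise different. Let h ≥ 0 be an operator on L consecutive sites such that H = ∑_{i=1}^N τ^i(h) is frustration free with ψ as a ground state, i.e. τ^i(h)ψ = 0 for every i. If N ≥ 3(b−1)(L_0+1) + L, then τ^i(h) ψ_{A^j} = 0 for every i and j; in particular every ψ_{A^j} is also a ground state of H, so H has at least b linearly independent ground states. -/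
open scoped Matrix ComplexOrder

open Submodule in
/-- The `n`-th power of the span of a family is spanned by the words of length `n`. -/
theorem span_range_pow_eq_span_words {R ι : Type*} [Ring R] [Algebra ℂ R] (P : ι → R) (n : ℕ) :
    span ℂ (Set.range P) ^ n =
      span ℂ (Set.range fun w : Fin n → ι => (List.ofFn fun k => P (w k)).prod) := by
  rw [Submodule.span_pow]
  congr 1
  ext x
  rw [Set.mem_pow]
  constructor
  · rintro ⟨f, rfl⟩
    choose w hw using fun k => (f k).2
    exact ⟨w, by simp [hw]⟩
  · rintro ⟨w, rfl⟩
    exact ⟨fun k => ⟨P (w k), w k, rfl⟩, rfl⟩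

section GeneratedPowers

open Submodule

variable {R E F ι : Type*} [Ring R] [Algebra ℂ R] [Ring E] [Algebra ℂ E] [Ring F] [Algebra ℂ F]

theorem generator_mul_mem_pow_succ {P : ι → R} {n : ℕ} {x : R}
    (hx : x ∈ span ℂ (Set.range P) ^ n) (i : ι) : P i * x ∈ span ℂ (Set.range P) ^ (n + 1) := by
  rw [add_comm, pow_add, pow_one]
  exact mul_mem_mul (subset_span ⟨i, rfl⟩) hx

theorem mul_generator_mem_pow_succ {P : ι → R} {n : ℕ} {x : R}
    (hx : x ∈ span ℂ (Set.range P) ^ n) (i : ι) : x * P i ∈ span ℂ (Set.range P) ^ (n + 1) := by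
  rw [pow_add, pow_one]
  exact mul_mem_mul hx (subset_span ⟨i, rfl⟩)

theorem mul_mem_pow_add {S : Submodule ℂ R} {m n : ℕ} {x y : R} (hx : x ∈ S ^ m)
    (hy : y ∈ S ^ n) : x * y ∈ S ^ (m + n) := by
  rw [pow_add]
  exact mul_mem_mul hx hy

theorem exists_eq_sum_mul_generator [Fintype ι] {P : ι → R} {n : ℕ} {p : R}
    (hp : p ∈ span ℂ (Set.range P) ^ (n + 1)) :
    ∃ q : ι → R, (∀ k, q k ∈ span ℂ (Set.range P) ^ n) ∧ p = ∑ k, q k * P k := by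
  rw [pow_succ] at hp
  refine Submodule.mul_induction_on hp (fun x hx y hy => ?_) ?_
  · obtain ⟨c, rfl⟩ := (Submodule.mem_span_range_iff_exists_fun ℂ).1 hy
    refine ⟨fun k => c k • x, fun k => Submodule.smul_mem _ _ hx, ?_⟩
    simp [Finset.mul_sum]
  · rintro x y ⟨q, hq, rfl⟩ ⟨r, hr, rfl⟩
    exact ⟨q + r, fun k => Submodule.add_mem _ (hq k) (hr k),
      by simp [add_mul, Finset.sum_add_distrib]⟩

theorem exists_mem_pow_map_eq [Fintype ι] {P : ι → R} (f : R →ₐ[ℂ] E) {Q : ι → E}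
    (hQ : ∑ i, f (P i) * Q i = 1) {m n : ℕ} (hmn : m ≤ n)
    (hm : ∀ X, ∃ p ∈ span ℂ (Set.range P) ^ m, f p = X) (X : E) :
    ∃ p ∈ span ℂ (Set.range P) ^ n, f p = X := by
  induction n, hmn using Nat.le_induction generalizing X with
  | base => exact hm X
  | succ n _ ih =>
    choose r hr hfr using fun i => ih (Q i * X)
    refine ⟨∑ i, P i * r i, Submodule.sum_mem _ fun i _ => generator_mul_mem_pow_succ (hr i) i, ?_⟩
    simp [hfr, ← mul_assoc, ← Finset.sum_mul, hQ]

/-- If the `g`-component of elements of `S ^ (n + 1)` is determined by their `f`-component, the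
same holds for `S ^ (n + 2)`. -/
theorem map_eq_zero_of_mem_pow_succ [Fintype ι] {P : ι → R} (f : R →ₐ[ℂ] E) (g : R →ₐ[ℂ] F)
    {Q : ι → E} (hQ : ∑ i, f (P i) * Q i = 1) {n : ℕ}
    (hn : ∀ X, ∃ p ∈ span ℂ (Set.range P) ^ n, f p = X)
    (hfg : ∀ p ∈ span ℂ (Set.range P) ^ (n + 1), f p = 0 → g p = 0) :
    ∀ p ∈ span ℂ (Set.range P) ^ (n + 2), f p = 0 → g p = 0 := by
  intro p hp hfp
  obtain ⟨q, hq, rfl⟩ := exists_eq_sum_mul_generator hp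
  choose r hr hfr using fun i k => hn (Q i * f (q k))
  have hgq : ∀ k, g (q k) = ∑ i, g (P i) * g (r i k) := by
    intro k
    have hmem : q k - ∑ i, P i * r i k ∈ span ℂ (Set.range P) ^ (n + 1) :=
      Submodule.sub_mem _ (hq k)
        (Submodule.sum_mem _ fun i _ => generator_mul_mem_pow_succ (hr i k) i)
    have := hfg _ hmem (by simp [hfr, ← mul_assoc, ← Finset.sum_mul, hQ])
    simpa [sub_eq_zero] using this
  have hgr : ∀ i, ∑ k, g (r i k) * g (P k) = 0 := by
    intro i
    have hmem : ∑ k, r i k * P k ∈ span ℂ (Set.range P) ^ (n + 1) :=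
      Submodule.sum_mem _ fun k _ => mul_generator_mem_pow_succ (hr i k) k
    have := hfg _ hmem (by
      have h0 : ∑ k, f (q k) * f (P k) = 0 := by simpa using hfp
      simp [hfr, mul_assoc, ← Finset.mul_sum, h0])
    simpa using this
  simp only [map_sum, map_mul, hgq, Finset.sum_mul]
  rw [Finset.sum_comm]
  simp [mul_assoc, ← Finset.mul_sum, hgr]

theorem map_eq_zero_of_mem_pow_of_succ [Fintype ι] {P : ι → R} (f : R →ₐ[ℂ] E)
    (g : R →ₐ[ℂ] F) {Q : ι → F} (hQ : ∑ i, g (P i) * Q i = 1) {n : ℕ}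
    (hfg : ∀ p ∈ span ℂ (Set.range P) ^ (n + 1), f p = 0 → g p = 0) :
    ∀ p ∈ span ℂ (Set.range P) ^ n, f p = 0 → g p = 0 := by
  intro p hp hfp
  have key : ∀ i, g p * g (P i) = 0 := fun i => by
    simpa using hfg _ (mul_generator_mem_pow_succ hp i) (by simp [hfp])
  rw [← mul_one (g p), ← hQ, Finset.mul_sum]
  simp [← mul_assoc, key]

theorem exists_linearMap_of_map_eq_zero {S : Submodule ℂ R} (f : R →ₐ[ℂ] E) (g : R →ₐ[ℂ] F)
    (hf : ∀ X, ∃ p ∈ S, f p = X) (hfg : ∀ p ∈ S, f p = 0 → g p = 0) :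
    ∃ φ : E →ₗ[ℂ] F, ∀ p ∈ S, φ (f p) = g p := by
  choose σ hσ hfσ using hf
  have hg : ∀ p ∈ S, ∀ q ∈ S, f p = f q → g p = g q := by
    intro p hp q hq h
    simpa [sub_eq_zero] using hfg _ (S.sub_mem hp hq) (by simp [h])
  refine ⟨⟨⟨fun X => g (σ X), fun X Y => ?_⟩, fun c X => ?_⟩, fun p hp => ?_⟩
  · rw [← map_add]
    exact hg _ (hσ _) _ (S.add_mem (hσ _) (hσ _)) (by simp [hfσ])
  · rw [RingHom.id_apply, ← map_smul]
    exact hg _ (hσ _) _ (S.smul_mem _ (hσ _)) (by simp [hfσ])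
  · exact hg _ (hσ _) _ hp (hfσ _)

/-- If the `g`-component is determined by the `f`-component at two consecutive injective lengths,
then the families `f ∘ P` and `g ∘ P` are equivalent up to a scalar and an algebra map. -/
theorem exists_algHom_smul_eq [Fintype ι] [Algebra.IsCentral ℂ F] [Nontrivial F] {P : ι → R}
    (f : R →ₐ[ℂ] E) (g : R →ₐ[ℂ] F) {Q : ι → E} (hQ : ∑ i, f (P i) * Q i = 1) {Q' : ι → F}
    (hQ' : ∑ i, g (P i) * Q' i = 1) {n : ℕ}
    (hf : ∀ X, ∃ p ∈ span ℂ (Set.range P) ^ n, f p = X)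
    (hg : ∀ X, ∃ p ∈ span ℂ (Set.range P) ^ n, g p = X)
    (hfg : ∀ p ∈ span ℂ (Set.range P) ^ (n + 1), f p = 0 → g p = 0) :
    ∃ (θ : E →ₐ[ℂ] F) (κ : ℂ), ∀ i, g (P i) = κ • θ (f (P i)) := by
  set S := span ℂ (Set.range P)
  have hfS : ∀ m, n ≤ m → ∀ X, ∃ p ∈ S ^ m, f p = X := fun m hm =>
    exists_mem_pow_map_eq f hQ hm hf
  have hgS : ∀ m, n ≤ m → ∀ X, ∃ p ∈ S ^ m, g p = X := fun m hm =>
    exists_mem_pow_map_eq g hQ' hm hg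
  have hker : ∀ m, n ≤ m → ∀ p ∈ S ^ m, f p = 0 → g p = 0 := by
    intro m hm
    rcases hm.eq_or_lt with rfl | hlt
    · exact map_eq_zero_of_mem_pow_of_succ f g hQ' hfg
    · induction m, Nat.succ_le_of_lt hlt using Nat.le_induction with
      | base => exact hfg
      | succ k hk ih =>
        obtain ⟨l, rfl⟩ : ∃ l, k = l + 1 := ⟨k - 1, by omega⟩
        exact map_eq_zero_of_mem_pow_succ f g hQ (hfS l (by omega)) (ih (by omega) (by omega))
  have hmap : ∀ m, n ≤ m → ∃ φ : E →ₗ[ℂ] F, ∀ p ∈ S ^ m, φ (f p) = g p := fun m hm =>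
    exists_linearMap_of_map_eq_zero f g (hfS m hm) (hker m hm)
  obtain ⟨φ, hφ⟩ := hmap n le_rfl
  obtain ⟨φ₁, hφ₁⟩ := hmap (n + 1) (by omega)
  obtain ⟨φ₂, hφ₂⟩ := hmap (n + n) (by omega)
  obtain ⟨φ₃, hφ₃⟩ := hmap (n + (n + 1)) (by omega)
  have hmul₂ : ∀ X Y, φ₂ (X * Y) = φ X * φ Y := by
    intro X Y
    obtain ⟨p, hp, rfl⟩ := hf X
    obtain ⟨q, hq, rfl⟩ := hf Y
    rw [← map_mul, hφ₂ _ (mul_mem_pow_add hp hq), hφ _ hp, hφ _ hq, map_mul]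
  have hmul₃ : ∀ X Y, φ₃ (X * Y) = φ X * φ₁ Y := by
    intro X Y
    obtain ⟨p, hp, rfl⟩ := hf X
    obtain ⟨q, hq, rfl⟩ := hfS (n + 1) (by omega) Y
    rw [← map_mul, hφ₃ _ (mul_mem_pow_add hp hq), hφ _ hp, hφ₁ _ hq, map_mul]
  have hmul₃' : ∀ X Y, φ₃ (X * Y) = φ₁ X * φ Y := by
    intro X Y
    obtain ⟨p, hp, rfl⟩ := hfS (n + 1) (by omega) X
    obtain ⟨q, hq, rfl⟩ := hf Y
    rw [← map_mul, hφ₃ _ (by convert mul_mem_pow_add hp hq using 2; omega), hφ₁ _ hp, hφ _ hq,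
      map_mul]
  have hφsurj : ∀ Y, ∃ X, φ X = Y := by
    intro Y
    obtain ⟨p, hp, rfl⟩ := hg Y
    exact ⟨f p, hφ p hp⟩
  have scalar_of_commute : ∀ Z : F, (∀ X, φ X * Z = Z * φ X) → ∃ z : ℂ, Z = algebraMap ℂ F z := by
    intro Z hZ
    refine (Algebra.IsCentral.mem_center_iff ℂ).1 (Subalgebra.mem_center_iff.2 fun Y => ?_)
    obtain ⟨X, rfl⟩ := hφsurj Y
    exact hZ X
  obtain ⟨z, hz⟩ := scalar_of_commute (φ 1) fun X => by
    rw [← hmul₂, ← hmul₂, mul_one, one_mul]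
  obtain ⟨c, hc⟩ := scalar_of_commute (φ₁ 1) fun X => by
    rw [← hmul₃, ← hmul₃', mul_one, one_mul]
  rw [Algebra.algebraMap_eq_smul_one] at hz hc
  have hz0 : z ≠ 0 := by
    rintro rfl
    obtain ⟨p, hp, hp1⟩ := hgS (n + n) (by omega) 1
    have := hφ₂ p hp
    rw [← mul_one (f p), hmul₂, hz, hp1] at this
    simp at this
  have hφφ₁ : ∀ X, z • φ₁ X = c • φ X := by
    intro X
    have := hmul₃ 1 X
    rw [hmul₃', hz, hc] at this
    simpa using this.symm
  refine ⟨AlgHom.ofLinearMap (z⁻¹ • φ) (by simp [hz, hz0]) fun X Y => ?_, z⁻¹ * c, fun i => ?_⟩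
  · have := hmul₂ 1 (X * Y)
    rw [one_mul, hmul₂, hz, smul_one_mul] at this
    simp [this, smul_smul, hz0]
  · obtain ⟨p, hp, hp1⟩ := hf 1
    have h1 : φ₁ (f (P i)) = z • g (P i) := by
      rw [← one_mul (f (P i)), ← hp1, ← map_mul, hφ₁ _ (mul_generator_mem_pow_succ hp i), map_mul,
        ← hφ p hp, hp1, hz, smul_one_mul]
    have h2 := hφφ₁ (f (P i))
    rw [h1] at h2
    simp only [AlgHom.ofLinearMap_apply, LinearMap.smul_apply]
    rw [mul_smul, smul_comm c, ← h2]
    simp [smul_smul, hz0]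

/-- Pair separation: if the `g`-component is not determined by the `f`-component, then `S ^ k`
contains elements with vanishing `f`-component and arbitrary `g`-component. -/
theorem exists_mem_pow_map_eq_zero_map_eq {D : Type*} [Fintype D] [DecidableEq D] {P : ι → R}
    (f : R →ₐ[ℂ] E) (g : R →ₐ[ℂ] Matrix D D ℂ) {m n k : ℕ}
    (hm : ∀ X, ∃ p ∈ span ℂ (Set.range P) ^ m, g p = X)
    (hk : ∀ X, ∃ p ∈ span ℂ (Set.range P) ^ k, g p = X)
    {x : R} (hx : x ∈ span ℂ (Set.range P) ^ n) (hfx : f x = 0) (hgx : g x ≠ 0)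
    (Y : Matrix D D ℂ) : ∃ p ∈ span ℂ (Set.range P) ^ (m + n + k), f p = 0 ∧ g p = Y := by
  obtain ⟨i, j, hij⟩ : ∃ i j, g x i j ≠ 0 := by
    by_contra! h
    exact hgx (Matrix.ext h)
  choose l hl hgl using fun a : D => hm (Matrix.single a i 1)
  choose r hr hgr using fun a : D × D => hk (Matrix.single j a.2 ((g x i j)⁻¹ * Y a.1 a.2))
  refine ⟨∑ a, ∑ b, l a * x * r (a, b), ?_, ?_, ?_⟩
  · exact Submodule.sum_mem _ fun a _ => Submodule.sum_mem _ fun b _ =>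
      mul_mem_pow_add (mul_mem_pow_add (hl a) hx) (hr _)
  · simp [hfx]
  · rw [Matrix.matrix_eq_sum_single Y]
    simp only [map_sum, map_mul, hgl, hgr]
    refine Finset.sum_congr rfl fun a _ => Finset.sum_congr rfl fun b _ => ?_
    ext u v
    simp [Matrix.single_mul_mul_single, hij]

end GeneratedPowers

/-- A linear functional on matrices that is invariant under cyclic permutation is a multiple of the
trace. -/
theorem Matrix.exists_eq_mul_trace_of_map_mul_comm {D : Type*} [Fintype D] [DecidableEq D]
    (φ : Matrix D D ℂ →ₗ[ℂ] ℂ) (hφ : ∀ X Y, φ (X * Y) = φ (Y * X)) :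
    ∃ α : ℂ, ∀ X, φ X = α * X.trace := by
  rcases isEmpty_or_nonempty D with hD | ⟨⟨o⟩⟩
  · exact ⟨0, fun X => by simp [Subsingleton.elim X 0]⟩
  · refine ⟨φ (Matrix.single o o 1), fun X => ?_⟩
    have key : ∀ a b, φ (Matrix.single a b (X a b)) =
        if a = b then φ (Matrix.single o o 1) * X a a else 0 := by
      intro a b
      have h1 : Matrix.single a b (X a b) = Matrix.single a o (X a b) * Matrix.single o b 1 := by
        simp
      rw [h1, hφ]
      split_ifs with hab
      · subst hab
        rw [Matrix.single_mul_single_same, one_mul, mul_comm, ← smul_eq_mul, ← map_smul,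
          Matrix.smul_single, smul_eq_mul, mul_one]
      · rw [Matrix.single_mul_single_of_ne _ _ _ _ (Ne.symm hab), map_zero]
    conv_lhs => rw [Matrix.matrix_eq_sum_single X]
    simp [key, Matrix.trace, Finset.mul_sum]

section Blocks

open Submodule

variable {J ι : Type*} {D : J → Type*} [∀ j, Fintype (D j)] [∀ j, DecidableEq (D j)]

theorem exists_mem_pow_card_mul [DecidableEq J] {S : Submodule ℂ ((j : J) → Matrix (D j) (D j) ℂ)}
    {r : ℕ} (j : J) (hS : ∀ k, k ≠ j → ∀ Y, ∃ p ∈ S ^ r, p k = 0 ∧ p j = Y) {s : Finset J}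
    (hs : s.Nonempty) (hj : j ∉ s) (Y : Matrix (D j) (D j) ℂ) :
    ∃ p ∈ S ^ (s.card * r), p j = Y ∧ ∀ k ∈ s, p k = 0 := by
  induction hs using Finset.Nonempty.cons_induction generalizing Y with
  | singleton a =>
    obtain ⟨p, hp, hpa, hpj⟩ := hS a (by rintro rfl; simp at hj) Y
    exact ⟨p, by simpa using hp, hpj, by simpa using hpa⟩
  | cons a s ha hs ih =>
    rw [Finset.mem_cons, not_or] at hj
    obtain ⟨p, hp, hpa, hpj⟩ := hS a (Ne.symm hj.1) Y
    obtain ⟨q, hq, hqj, hqs⟩ := ih hj.2 1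
    refine ⟨q * p, ?_, by simp [hqj, hpj], ?_⟩
    · rw [Finset.card_cons, add_mul, one_mul]
      exact mul_mem_pow_add hq hp
    · intro k hk
      rcases Finset.mem_cons.1 hk with rfl | hk
      · simp [hpa]
      · simp [hqs k hk]

/-- Pairwise separation of the blocks at length `r` gives joint injectivity at length
`(card J - 1) * r`. -/
theorem pow_eq_top_of_pairwise [Fintype J] [DecidableEq J]
    {S : Submodule ℂ ((j : J) → Matrix (D j) (D j) ℂ)} {r : ℕ} (hJ : 2 ≤ Fintype.card J)
    (hS : ∀ j k, k ≠ j → ∀ Y, ∃ p ∈ S ^ r, p k = 0 ∧ p j = Y) :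
    S ^ ((Fintype.card J - 1) * r) = ⊤ := by
  refine eq_top_iff.2 fun x _ => ?_
  have hcard : ∀ j : J, (Finset.univ.erase j).card = Fintype.card J - 1 := fun j => by
    rw [Finset.card_erase_of_mem (Finset.mem_univ j), Finset.card_univ]
  choose p hp hpj hpk using fun j => exists_mem_pow_card_mul j (hS j) (s := Finset.univ.erase j)
    (Finset.card_pos.1 (by rw [hcard]; omega)) (Finset.notMem_erase _ _) (x j)
  have hx : x = ∑ j, p j := by
    ext1 k
    rw [Finset.sum_apply, Finset.sum_eq_single k (fun j _ hjk => hpk j k (by simp [hjk.symm]))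
      (by simp), hpj]
  rw [hx]
  exact Submodule.sum_mem _ fun j _ => hcard j ▸ hp j

theorem exists_mem_pow_apply_eq {A : (j : J) → ι → Matrix (D j) (D j) ℂ} {j : J} {n : ℕ}
    (hA : span ℂ {M : Matrix (D j) (D j) ℂ |
      ∃ w : Fin n → ι, M = (List.ofFn fun k => A j (w k)).prod} = ⊤) (X : Matrix (D j) (D j) ℂ) :
    ∃ p ∈ span ℂ (Set.range fun i j => A j i) ^ n,
      Pi.evalAlgHom ℂ (fun j => Matrix (D j) (D j) ℂ) j p = X := by
  have hX : X ∈ (span ℂ (Set.range fun i j => A j i) ^ n).map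
      (Pi.evalAlgHom ℂ (fun j => Matrix (D j) (D j) ℂ) j).toLinearMap := by
    rw [span_range_pow_eq_span_words, Submodule.map_span, ← Set.range_comp]
    convert (Submodule.mem_top : X ∈ ⊤)
    rw [← hA]
    congr 1
    ext M
    simp only [Set.mem_range, Set.mem_ofPred_eq, Function.comp_apply, AlgHom.toLinearMap_apply,
      map_list_prod, List.map_ofFn]
    exact exists_congr fun w => eq_comm
  simpa using hX

theorem trace_mul_word_eq_zero [Fintype J] {A : (j : J) → ι → Matrix (D j) (D j) ℂ} {n : ℕ}
    (hA : span ℂ (Set.range fun i j => A j i) ^ n = ⊤) (X : (j : J) → Matrix (D j) (D j) ℂ)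
    (hX : ∀ w : Fin n → ι, ∑ j, (X j * (List.ofFn fun k => A j (w k)).prod).trace = 0) (j : J)
    (w : Fin n → ι) : (X j * (List.ofFn fun k => A j (w k)).prod).trace = 0 := by
  classical
  have hall : ∀ p : (j : J) → Matrix (D j) (D j) ℂ, ∑ j, (X j * p j).trace = 0 := by
    intro p
    have hp : p ∈ span ℂ (Set.range fun i j => A j i) ^ n := hA ▸ Submodule.mem_top
    rw [span_range_pow_eq_span_words] at hp
    induction hp using Submodule.span_induction with
    | mem x hx =>
      obtain ⟨w, rfl⟩ := hx
      have : ∀ j, (List.ofFn fun k => fun j => A j (w k)).prod j =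
          (List.ofFn fun k => A j (w k)).prod := fun j => by
        simpa [List.map_ofFn, Function.comp_def] using
          map_list_prod (Pi.evalMonoidHom (fun j => Matrix (D j) (D j) ℂ) j)
            (List.ofFn fun k => fun j => A j (w k))
      simpa [this] using hX w
    | zero => simp
    | add x y _ _ hx hy => simp [mul_add, Finset.sum_add_distrib, hx, hy]
    | smul c x _ hx => simp [← Finset.mul_sum, hx]
  have := hall (Pi.single j (List.ofFn fun k => A j (w k)).prod)
  rw [Finset.sum_eq_single j (fun k _ hk => by simp [hk]) (by simp)] at this
  simpa using this

end Blocks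

theorem List.prod_ofFn_smul_algHom {E F : Type*} [Ring E] [Algebra ℂ E] [Ring F] [Algebra ℂ F]
    (θ : E →ₐ[ℂ] F) (κ : ℂ) {n : ℕ} (x : Fin n → E) :
    (List.ofFn fun k => κ • θ (x k)).prod = κ ^ n • θ (List.ofFn x).prod := by
  induction n with
  | zero => simp
  | succ n ih => simp [ih, pow_succ, mul_smul]

theorem tiCoeff_eq_mul_of_eq_smul_algHom {d D D' N : ℕ} {A : Fin d → Matrix (Fin D) (Fin D) ℂ}
    {B : Fin d → Matrix (Fin D') (Fin D') ℂ}
    {θ : Matrix (Fin D) (Fin D) ℂ →ₐ[ℂ] Matrix (Fin D') (Fin D') ℂ} {κ : ℂ}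
    (hB : ∀ i, B i = κ • θ (A i)) :
    ∃ z : ℂ, ∀ i : Fin N → Fin d, tiCoeff B i = z * tiCoeff A i := by
  obtain ⟨α, hα⟩ := Matrix.exists_eq_mul_trace_of_map_mul_comm
    (Matrix.traceLinearMap (Fin D') ℂ ℂ ∘ₗ θ.toLinearMap)
    (fun X Y => by simp [Matrix.trace_mul_comm (θ X)])
  refine ⟨κ ^ N * α, fun i => ?_⟩
  have h := hα (List.ofFn fun k => A (i k)).prod
  simp only [LinearMap.comp_apply, AlgHom.toLinearMap_apply, Matrix.traceLinearMap_apply] at h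
  simp only [tiCoeff, hB]
  rw [List.prod_ofFn_smul_algHom, Matrix.trace_smul, h, smul_eq_mul, mul_assoc]

theorem List.ofFn_comp_add_eq_rotate {α : Type*} {N : ℕ} (v : Fin N → α) (t : Fin N) :
    (List.ofFn fun k => v (k + t)) = (List.ofFn v).rotate t := by
  refine List.ext_getElem (by simp) fun n h₁ h₂ => ?_
  rw [List.getElem_rotate]
  simp [Fin.add_def]

theorem tiCoeff_comp_add {d D N : ℕ} (A : Fin d → Matrix (Fin D) (Fin D) ℂ) (v : Fin N → Fin d)
    (t : Fin N) : tiCoeff A (fun k => v (k + t)) = tiCoeff A v := by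
  simp only [tiCoeff]
  rw [List.ofFn_comp_add_eq_rotate (fun k => A (v k)) t,
    List.rotate_eq_drop_append_take (by simp [t.2.le]), List.prod_append, Matrix.trace_mul_comm,
    ← List.prod_append, List.take_append_drop]

theorem tiCoeff_append {d D L M : ℕ} (A : Fin d → Matrix (Fin D) (Fin D) ℂ) (x : Fin L → Fin d)
    (y : Fin M → Fin d) :
    tiCoeff A (Fin.append x y) =
      ((List.ofFn fun k => A (x k)).prod * (List.ofFn fun k => A (y k)).prod).trace := by
  simp only [tiCoeff]
  rw [← List.prod_append, ← List.ofFn_fin_append]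
  congr 3
  ext k
  refine Fin.addCases (fun k => ?_) (fun k => ?_) k <;> simp

/-- Splitting a configuration on a ring into the window of length `L` after site `t` and the rest. -/
def windowEquiv (d : ℕ) {L M : ℕ} [NeZero (L + M)] (t : Fin (L + M)) :
    (Fin L → Fin d) × (Fin M → Fin d) ≃ (Fin (L + M) → Fin d) :=
  (Fin.appendEquiv L M).trans ((Equiv.subRight t).symm.arrowCongr (Equiv.refl _))

theorem windowEquiv_apply {d L M : ℕ} [NeZero (L + M)] (t k : Fin (L + M))
    (x : Fin L → Fin d) (y : Fin M → Fin d) :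
    windowEquiv d t (x, y) k = Fin.append x y (k - t) := rfl

theorem tiCoeff_windowEquiv {d D L M : ℕ} [NeZero (L + M)] (A : Fin d → Matrix (Fin D) (Fin D) ℂ)
    (t : Fin (L + M)) (x : Fin L → Fin d) (y : Fin M → Fin d) :
    tiCoeff A (windowEquiv d t (x, y)) =
      ((List.ofFn fun k => A (x k)).prod * (List.ofFn fun k => A (y k)).prod).trace := by
  rw [← tiCoeff_comp_add _ _ t, ← tiCoeff_append]
  simp [windowEquiv_apply]

theorem window_mulVec_apply {d L M : ℕ} [NeZero (L + M)] (hL : L ≤ L + M) (t : Fin (L + M))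
    (h : Matrix (Fin L → Fin d) (Fin L → Fin d) ℂ) (φ : (Fin (L + M) → Fin d) → ℂ)
    (x : Fin L → Fin d) (y : Fin M → Fin d) :
    (Matrix.of fun u v : Fin (L + M) → Fin d =>
        (if ∀ k : Fin (L + M), (∀ r : Fin L, k ≠ t + Fin.castLE hL r) → u k = v k
          then 1 else 0) *
          h (fun r => u (t + Fin.castLE hL r)) (fun r => v (t + Fin.castLE hL r))).mulVec φ
        (windowEquiv d t (x, y)) =
      ∑ x', h x x' * φ (windowEquiv d t (x', y)) := by
  have hcast : ∀ r : Fin L, Fin.castLE hL r = Fin.castAdd M r := fun _ => rfl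
  have hwin : ∀ (x : Fin L → Fin d) (y : Fin M → Fin d) (r : Fin L),
      windowEquiv d t (x, y) (t + Fin.castLE hL r) = x r := fun x y r => by
    rw [windowEquiv_apply, hcast, add_sub_cancel_left, Fin.append_left]
  have hrest : ∀ (x x' : Fin L → Fin d) (y y' : Fin M → Fin d),
      (∀ k : Fin (L + M), (∀ r : Fin L, k ≠ t + Fin.castLE hL r) →
        windowEquiv d t (x, y) k = windowEquiv d t (x', y') k) ↔ y = y' := by
    intro x x' y y'
    constructor
    · intro H
      ext1 s
      have := H (t + Fin.natAdd L s) fun r hr => by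
        have := congrArg Fin.val (add_left_cancel hr)
        simp at this
        omega
      simpa [windowEquiv_apply] using this
    · rintro rfl k hk
      simp only [windowEquiv_apply]
      obtain ⟨k, rfl⟩ : ∃ l, k = t + l := ⟨k - t, by simp⟩
      rw [add_sub_cancel_left]
      induction k using Fin.addCases with
      | left r => exact absurd rfl (hk r)
      | right s => simp
  simp only [Matrix.mulVec, dotProduct, Matrix.of_apply]
  rw [← (windowEquiv d t).sum_comp, Fintype.sum_prod_type]
  simp [hwin, hrest]

/-- Families satisfying condition C1 at length `L0`, no one of which is the image of another under
a scalar multiple of an algebra map, are jointly injective at length `3 * (b - 1) * (L0 + 1)`. -/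
theorem span_pow_eq_top_of_not_equivalent {d b L0 n : ℕ} (hb : 2 ≤ b) {Ds : Fin b → ℕ}
    [∀ j, Nontrivial (Matrix (Fin (Ds j)) (Fin (Ds j)) ℂ)]
    {A : (j : Fin b) → Fin d → Matrix (Fin (Ds j)) (Fin (Ds j)) ℂ}
    (hiso : ∀ j, (∑ i, A j i * (A j i)ᴴ) = 1)
    (hC1 : ∀ j, Submodule.span ℂ
      {M : Matrix (Fin (Ds j)) (Fin (Ds j)) ℂ |
        ∃ i : Fin L0 → Fin d, M = (List.ofFn fun k => A j (i k)).prod} = ⊤)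
    (hdiff : ∀ j k, k ≠ j →
      ∀ (θ : Matrix (Fin (Ds k)) (Fin (Ds k)) ℂ →ₐ[ℂ] Matrix (Fin (Ds j)) (Fin (Ds j)) ℂ) (κ : ℂ),
        ¬ ∀ i, A j i = κ • θ (A k i))
    (hn : 3 * (b - 1) * (L0 + 1) ≤ n) :
    Submodule.span ℂ (Set.range fun i j => A j i) ^ n = ⊤ := by
  set S := Submodule.span ℂ (Set.range fun i j => A j i)
  have hsurj : ∀ j n, L0 ≤ n → ∀ X, ∃ p ∈ S ^ n,
      Pi.evalAlgHom ℂ (fun j => Matrix (Fin (Ds j)) (Fin (Ds j)) ℂ) j p = X := fun j n hn =>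
    exists_mem_pow_map_eq (Pi.evalAlgHom ℂ (fun j => Matrix (Fin (Ds j)) (Fin (Ds j)) ℂ) j)
      (P := fun i j => A j i) (Q := fun i => (A j i)ᴴ) (hiso j) hn (exists_mem_pow_apply_eq (A := A) (hC1 j))
  have hpair : ∀ j k, k ≠ j → ∀ Y, ∃ p ∈ S ^ (L0 + (L0 + 1) + (L0 + 2)), p k = 0 ∧ p j = Y := by
    intro j k hkj
    by_cases hker : ∀ p ∈ S ^ (L0 + 1), p k = 0 → p j = 0
    · obtain ⟨θ, κ, hθ⟩ := exists_algHom_smul_eq (P := fun i j => A j i)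
        (Pi.evalAlgHom ℂ (fun j => Matrix (Fin (Ds j)) (Fin (Ds j)) ℂ) k)
        (Pi.evalAlgHom ℂ (fun j => Matrix (Fin (Ds j)) (Fin (Ds j)) ℂ) j)
        (Q := fun i => (A k i)ᴴ) (Q' := fun i => (A j i)ᴴ) (hiso k) (hiso j) (hsurj k L0 le_rfl) (hsurj j L0 le_rfl) hker
      exact absurd hθ (hdiff j k hkj θ κ)
    · push Not at hker
      obtain ⟨x, hx, hxk, hxj⟩ := hker
      exact exists_mem_pow_map_eq_zero_map_eq (P := fun i j => A j i)
        (Pi.evalAlgHom ℂ (fun j => Matrix (Fin (Ds j)) (Fin (Ds j)) ℂ) k)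
        (Pi.evalAlgHom ℂ (fun j => Matrix (Fin (Ds j)) (Fin (Ds j)) ℂ) j)
        (hsurj j L0 le_rfl) (hsurj j (L0 + 2) (by omega)) hx hxk hxj
  have hbase := pow_eq_top_of_pairwise (by simpa using hb) hpair
  have hle : (Fintype.card (Fin b) - 1) * (L0 + (L0 + 1) + (L0 + 2)) ≤ n := by
    rw [Fintype.card_fin]
    convert hn using 1
    ring
  refine eq_top_iff.2 fun x _ => ?_
  obtain ⟨p, hp, rfl⟩ := exists_mem_pow_map_eq (AlgHom.id ℂ _) (P := fun i j => A j i)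
    (Q := fun i j => (A j i)ᴴ)
    (by ext1 j; simpa using hiso j) hle (fun X => ⟨X, hbase ▸ Submodule.mem_top, rfl⟩) x
  exact hp

/-- Degeneracy of the ground space, v1.  Let
`ψ = ∑ⱼ ψ_{Aʲ}` with `b ≥ 2` blocks, each `ψ_{Aʲ}` the TI MPS with coefficients
`λⱼ^N tr(Aʲ_{i₁}⋯Aʲ_{i_N})`, the families `Aʲ` in single-block canonical form
satisfying condition C1 with parameter `L0` and generating pairwise different
(non-proportional) states.  If `h ≥ 0` acts on `L` consecutive sites,
`N ≥ 3(b-1)(L0+1) + L`, and `τ^t(h) ψ = 0` for all translates `t`, then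
`τ^t(h) ψ_{Aʲ} = 0` for all `t, j`; in particular the `ψ_{Aʲ}` are `b` linearly
independent ground states of `H = ∑ₜ τ^t(h)`. -/
theorem stmt_13 (N d b L0 L : ℕ) (hb : 2 ≤ b) (hLN : L ≤ N)
    (Ds : Fin b → ℕ)
    (A : (j : Fin b) → Fin d → Matrix (Fin (Ds j)) (Fin (Ds j)) ℂ)
    (lam : Fin b → ℝ) (hlam : ∀ j, 0 < lam j)
    (Λ : (j : Fin b) → Matrix (Fin (Ds j)) (Fin (Ds j)) ℂ)
    (hiso : ∀ j, (∑ i, A j i * (A j i)ᴴ) = 1)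
    (hΛ : ∀ j, (Λ j).IsDiag ∧ (Λ j).PosDef ∧
      (∑ i, (A j i)ᴴ * Λ j * A j i) = Λ j)
    (hfix : ∀ j (X : Matrix (Fin (Ds j)) (Fin (Ds j)) ℂ),
      (∑ i, A j i * X * (A j i)ᴴ) = X → ∃ z : ℂ, X = z • 1)
    (hC1 : ∀ j, Submodule.span ℂ
      {M : Matrix (Fin (Ds j)) (Fin (Ds j)) ℂ |
        ∃ i : Fin L0 → Fin d, M = (List.ofFn fun k => A j (i k)).prod} = ⊤)
    (hdiff : ∀ j j', j ≠ j' →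
      ¬ ∃ z : ℂ, ∀ i : Fin N → Fin d,
        ((lam j : ℂ) ^ N) * tiCoeff (A j) i =
          z * (((lam j' : ℂ) ^ N) * tiCoeff (A j') i))
    (hNsize : 3 * (b - 1) * (L0 + 1) + L ≤ N)
    (h : Matrix (Fin L → Fin d) (Fin L → Fin d) ℂ) (hpsd : h.PosSemidef)
    (ψ : (Fin N → Fin d) → ℂ)
    (hψ : ∀ i : Fin N → Fin d,
      ψ i = ∑ j, ((lam j : ℂ) ^ N) * tiCoeff (A j) i) :
    let tau : Fin N → Matrix (Fin N → Fin d) (Fin N → Fin d) ℂ := fun t =>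
      Matrix.of fun u v =>
        (if ∀ k : Fin N, (∀ r : Fin L, k ≠ t + Fin.castLE hLN r) → u k = v k
          then 1 else 0) *
          h (fun r => u (t + Fin.castLE hLN r)) (fun r => v (t + Fin.castLE hLN r))
    (∀ t : Fin N, (tau t).mulVec ψ = 0) →
      (∀ (t : Fin N) (j : Fin b),
        (tau t).mulVec (fun i => ((lam j : ℂ) ^ N) * tiCoeff (A j) i) = 0) ∧
      LinearIndependent ℂ
        (fun (j : Fin b) => fun (i : Fin N → Fin d) =>
          ((lam j : ℂ) ^ N) * tiCoeff (A j) i) := by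
  intro tau htau
  have hneg : ∀ j, ∃ w : Fin N → Fin d, ((lam j : ℂ) ^ N) * tiCoeff (A j) w ≠ 0 := by
    intro j
    obtain ⟨k, hk⟩ : ∃ k : Fin b, j ≠ k := by
      have : Nontrivial (Fin b) := Fin.nontrivial_iff_two_le.2 hb
      exact (exists_ne j).imp fun _ => Ne.symm
    by_contra! H
    exact hdiff j k hk ⟨0, fun w => by rw [H w, zero_mul]⟩
  have hlam0 : ∀ j, ((lam j : ℂ) ^ N) ≠ 0 := fun j =>
    pow_ne_zero _ (Complex.ofReal_ne_zero.2 (hlam j).ne')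
  have hnontriv : ∀ j, Nontrivial (Matrix (Fin (Ds j)) (Fin (Ds j)) ℂ) := by
    intro j
    by_contra H
    have := not_nontrivial_iff_subsingleton.1 H
    obtain ⟨w, hw⟩ := hneg j
    refine hw ?_
    rw [tiCoeff, Subsingleton.elim (List.prod _) 0, Matrix.trace_zero, mul_zero]
  have htop : ∀ n, 3 * (b - 1) * (L0 + 1) ≤ n →
      Submodule.span ℂ (Set.range fun i j => A j i) ^ n = ⊤ := fun n =>
    span_pow_eq_top_of_not_equivalent hb hiso hC1 fun j k hkj θ κ hθ => by
      obtain ⟨z, hz⟩ := tiCoeff_eq_mul_of_eq_smul_algHom (N := N) hθ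
      refine hdiff j k hkj.symm ⟨(lam j : ℂ) ^ N * z / (lam k : ℂ) ^ N, fun i => ?_⟩
      have := hlam0 k
      rw [hz]
      field_simp
  refine ⟨fun t j => ?_, ?_⟩
  · obtain ⟨M, rfl⟩ := Nat.exists_eq_add_of_le hLN
    have : NeZero (L + M) := ⟨by have := t.2; omega⟩
    have hblock : ∀ (j : Fin b) (x : Fin L → Fin d) (y : Fin M → Fin d),
        (tau t).mulVec (fun i => ((lam j : ℂ) ^ (L + M)) * tiCoeff (A j) i)
          (windowEquiv d t (x, y)) =
        ((∑ x', (h x x' * (lam j : ℂ) ^ (L + M)) • (List.ofFn fun k => A j (x' k)).prod) *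
          (List.ofFn fun k => A j (y k)).prod).trace := by
      intro j x y
      rw [window_mulVec_apply hLN t h]
      simp only [tiCoeff_windowEquiv, Finset.sum_mul, Matrix.trace_sum, smul_mul_assoc,
        Matrix.trace_smul, smul_eq_mul, mul_assoc]
    have hψ' : ψ = ∑ j, fun i => ((lam j : ℂ) ^ (L + M)) * tiCoeff (A j) i := by
      ext i
      rw [hψ, Finset.sum_apply]
    ext u
    obtain ⟨⟨x, y⟩, rfl⟩ := (windowEquiv d t).surjective u
    rw [hblock, Pi.zero_apply]
    refine trace_mul_word_eq_zero (htop M (by omega)) (fun j => ∑ x',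
      (h x x' * (lam j : ℂ) ^ (L + M)) • (List.ofFn fun k => A j (x' k)).prod) (fun y => ?_) j y
    have := congrFun (htau t) (windowEquiv d t (x, y))
    rw [hψ', Matrix.mulVec_sum, Finset.sum_apply, Pi.zero_apply] at this
    simpa only [hblock] using this
  · rw [Fintype.linearIndependent_iff]
    intro c hc j
    obtain ⟨w, hw⟩ := hneg j
    have h0 := trace_mul_word_eq_zero (htop N (by omega))
      (fun j => (c j * (lam j : ℂ) ^ N) • (1 : Matrix (Fin (Ds j)) (Fin (Ds j)) ℂ))
      (fun w => by
        have := congrFun hc w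
        simpa [Finset.sum_apply, tiCoeff, mul_assoc] using this) j w
    rw [smul_one_mul, Matrix.trace_smul, smul_eq_mul, mul_assoc] at h0
    exact (mul_eq_zero.1 h0).resolve_right hw
end
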